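/- arXiv:2507.19746 — 13 statements merged into one kernel-verified Lean document; each statement's English description precedes it below -/
import Mathlib

section
/- Assume (i) g2(0) > h2(0), h2(2) > f2(0) > h2(1) > g2(1), and h2(2) > f2(1); and (ii) h1(1) > h1(2) > max{f1(0), g1(0)}. Then the unique maximizer of τ ↦ V_0(τ) over τ ∈ {0,1,2} is τ = 2, whereas the unique maximizer of τ ↦ V_1(τ) over τ ∈ {1,2} is τ = 1. In particular, the leader's precommitment problem is time-inconsistent: the time-0 optimal stopping plan τ = 2 differs from the time-1 optimal plan τ = 1. -/
namespace Stmt0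

noncomputable section

/-- Leader's payoff in the deterministic two-period game. -/
def F1 (f1 g1 h1 : Fin 3 → ℝ) (τ ρ : Fin 3) : ℝ :=
  if τ < ρ then f1 τ else if ρ < τ then g1 ρ else h1 τ

/-- Follower's payoff in the deterministic two-period game. -/
def F2 (f2 g2 h2 : Fin 3 → ℝ) (τ ρ : Fin 3) : ℝ :=
  if ρ < τ then f2 ρ else if τ < ρ then g2 τ else h2 ρ

/-- Under conditions (i) and (ii), the unique maximizer of `V₀` over `{0,1,2}` is `τ = 2`,
whereas the unique maximizer of `V₁` over `{1,2}` is `τ = 1`: the leader's precommitment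
problem is time-inconsistent. Here `ρstar t τ` is the follower's best response, i.e. the
earliest maximizer of `ρ ↦ F2 τ ρ` over `ρ ∈ {t,...,2}`, and `V_t(τ) = F1 τ (ρstar t τ)`. -/
theorem time_inconsistency (f1 g1 h1 f2 g2 h2 : Fin 3 → ℝ)
    (ρstar : Fin 3 → Fin 3 → Fin 3)
    (hρ_ge : ∀ t τ : Fin 3, t ≤ ρstar t τ)
    (hρ_max : ∀ t τ ρ : Fin 3, t ≤ ρ →
      F2 f2 g2 h2 τ ρ ≤ F2 f2 g2 h2 τ (ρstar t τ))
    (hρ_min : ∀ t τ ρ : Fin 3, t ≤ ρ →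
      F2 f2 g2 h2 τ ρ = F2 f2 g2 h2 τ (ρstar t τ) → ρstar t τ ≤ ρ)
    -- condition (i)
    (ci1 : g2 0 > h2 0) (ci2 : h2 2 > f2 0) (ci3 : f2 0 > h2 1) (ci4 : h2 1 > g2 1)
    (ci5 : h2 2 > f2 1)
    -- condition (ii)
    (cii1 : h1 1 > h1 2) (cii2 : h1 2 > max (f1 0) (g1 0)) :
    (∀ τ : Fin 3, τ ≠ 2 → F1 f1 g1 h1 τ (ρstar 0 τ) < F1 f1 g1 h1 2 (ρstar 0 2)) ∧
    (∀ τ : Fin 3, 1 ≤ τ → τ ≠ 1 → F1 f1 g1 h1 τ (ρstar 1 τ) < F1 f1 g1 h1 1 (ρstar 1 1)) := by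
  obtain ⟨hf, hg⟩ := max_lt_iff.mp cii2
  have h00 : ρstar 0 0 ≠ 0 := by
    intro h
    have hle := hρ_max 0 0 1 (by decide)
    rw [h] at hle
    simp [F2] at hle
    linarith
  have h01 : ρstar 0 1 = 0 := by
    have hle := hρ_max 0 1 0 le_rfl
    generalize ρstar 0 1 = r at hle ⊢
    fin_cases r <;> simp [F2] at hle ⊢ <;> linarith
  have h02 : ρstar 0 2 = 2 := by
    have hle := hρ_max 0 2 2 (by decide)
    generalize ρstar 0 2 = r at hle ⊢
    fin_cases r <;> simp [F2] at hle ⊢ <;> linarith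
  have h11 : ρstar 1 1 = 1 := by
    have hge := hρ_ge 1 1
    have hle := hρ_max 1 1 1 le_rfl
    generalize ρstar 1 1 = r at hge hle ⊢
    fin_cases r <;> simp [F2] at hge hle ⊢ <;> linarith
  have h12 : ρstar 1 2 = 2 := by
    have hge := hρ_ge 1 2
    have hle := hρ_max 1 2 2 (by decide)
    generalize ρstar 1 2 = r at hge hle ⊢
    fin_cases r <;> simp [F2] at hge hle ⊢ <;> linarith
  constructor
  · intro τ hτ
    fin_cases τ
    · simpa [F1, h02, Fin.pos_iff_ne_zero, h00] using hf
    · simpa [F1, h01, h02] using hg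
    · exact absurd rfl hτ
  · intro τ hτ hτ'
    fin_cases τ
    · simp at hτ
    · exact absurd rfl hτ'
    · simpa [F1, h11, h12] using cii1

end

end Stmt0
end

section
/- Assume (i) g2(0) > h2(0), h2(2) > f2(0) > h2(1) > g2(1), h2(2) > f2(1); (ii) h1(1) > h1(2) > max{f1(0), g1(0)}; (iii) f1(0) > g1(0); (iv) g1(0) > h1(0); (v) h1(1) > g1(1) and f1(1) > h1(2). Then: (a) the unique maximizer of V_0 over {0,1,2} is τ = 2 (the precommitment strategy continues until the terminal time); (b) the unique maximizer of V_1 over {1,2} is τ = 1 and V_0(0) > V_0(1), so the backward-induction (time-consistent) equilibrium strategy stops at time 0; (c) the pair (τ,ρ) = (1,0) is a Nash equilibrium of the simultaneous-move game, i.e. F1(1,0) ≥ F1(τ,0) for all τ ∈ {0,1,2} and F2(1,0) ≥ F2(1,ρ) for all ρ ∈ {0,1,2}. Hence the precommitment strategy, the equilibrium strategy and the Nash equilibrium prescribe three different actions for the leader at time 0. -/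
namespace Stmt1

noncomputable section

/-- Leader's payoff in the deterministic two-period game. -/
def F1 (f1 g1 h1 : Fin 3 → ℝ) (τ ρ : Fin 3) : ℝ :=
  if τ < ρ then f1 τ else if ρ < τ then g1 ρ else h1 τ

/-- Follower's payoff in the deterministic two-period game. -/
def F2 (f2 g2 h2 : Fin 3 → ℝ) (τ ρ : Fin 3) : ℝ :=
  if ρ < τ then f2 ρ else if τ < ρ then g2 τ else h2 ρ

/-- Under conditions (i)–(v): (a) the unique maximizer of `V₀` over `{0,1,2}` is `τ = 2`;
(b) the unique maximizer of `V₁` over `{1,2}` is `τ = 1` and `V₀(0) > V₀(1)`, so the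
backward-induction equilibrium stops at time `0`; (c) the pair `(τ,ρ) = (1,0)` is a Nash
equilibrium of the simultaneous-move game. Hence precommitment, equilibrium and Nash
equilibrium prescribe three different actions for the leader at time `0`.
Here `ρstar t τ` is the follower's best response (earliest maximizer of `ρ ↦ F2 τ ρ` over
`ρ ∈ {t,...,2}`) and `V_t(τ) = F1 τ (ρstar t τ)`. -/
theorem distinct_notions (f1 g1 h1 f2 g2 h2 : Fin 3 → ℝ)
    (ρstar : Fin 3 → Fin 3 → Fin 3)
    (hρ_ge : ∀ t τ : Fin 3, t ≤ ρstar t τ)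
    (hρ_max : ∀ t τ ρ : Fin 3, t ≤ ρ →
      F2 f2 g2 h2 τ ρ ≤ F2 f2 g2 h2 τ (ρstar t τ))
    (hρ_min : ∀ t τ ρ : Fin 3, t ≤ ρ →
      F2 f2 g2 h2 τ ρ = F2 f2 g2 h2 τ (ρstar t τ) → ρstar t τ ≤ ρ)
    -- condition (i)
    (ci1 : g2 0 > h2 0) (ci2 : h2 2 > f2 0) (ci3 : f2 0 > h2 1) (ci4 : h2 1 > g2 1)
    (ci5 : h2 2 > f2 1)
    -- condition (ii)
    (cii1 : h1 1 > h1 2) (cii2 : h1 2 > max (f1 0) (g1 0))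
    -- condition (iii)
    (ciii : f1 0 > g1 0)
    -- condition (iv)
    (civ : g1 0 > h1 0)
    -- condition (v)
    (cv1 : h1 1 > g1 1) (cv2 : f1 1 > h1 2) :
    -- (a) the precommitment strategy at time 0 is τ = 2
    (∀ τ : Fin 3, τ ≠ 2 → F1 f1 g1 h1 τ (ρstar 0 τ) < F1 f1 g1 h1 2 (ρstar 0 2)) ∧
    -- (b) the unique maximizer of V₁ over {1,2} is τ = 1, and V₀(0) > V₀(1)
    ((∀ τ : Fin 3, 1 ≤ τ → τ ≠ 1 → F1 f1 g1 h1 τ (ρstar 1 τ) < F1 f1 g1 h1 1 (ρstar 1 1)) ∧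
      F1 f1 g1 h1 0 (ρstar 0 0) > F1 f1 g1 h1 1 (ρstar 0 1)) ∧
    -- (c) (τ,ρ) = (1,0) is a Nash equilibrium of the simultaneous-move game
    ((∀ τ : Fin 3, F1 f1 g1 h1 τ 0 ≤ F1 f1 g1 h1 1 0) ∧
      (∀ ρ : Fin 3, F2 f2 g2 h2 1 ρ ≤ F2 f2 g2 h2 1 0)) := by
  have V00 : ρstar 0 0 = 1 := by
    have hmax := hρ_max 0 0 1 (by decide)
    have hmin := hρ_min 0 0 1 (by decide)
    generalize ρstar 0 0 = r at hmax hmin ⊢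
    fin_cases r
    · simp [F2] at hmax
      linarith
    · rfl
    · simp [F2] at hmin
  have V01 : ρstar 0 1 = 0 := by
    have hmax := hρ_max 0 1 0 (by decide)
    generalize ρstar 0 1 = r at hmax ⊢
    fin_cases r
    · rfl
    all_goals
      simp [F2] at hmax
      linarith
  have V02 : ρstar 0 2 = 2 := by
    have hmax := hρ_max 0 2 2 (by decide)
    generalize ρstar 0 2 = r at hmax ⊢
    fin_cases r
    iterate 2
      · simp [F2] at hmax
        linarith
    · rfl
  have V11 : ρstar 1 1 = 1 := by
    have hge := hρ_ge 1 1
    have hmax := hρ_max 1 1 1 (by decide)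
    generalize ρstar 1 1 = r at hge hmax ⊢
    fin_cases r
    · simp at hge
    · rfl
    · simp [F2] at hmax
      linarith
  have V12 : ρstar 1 2 = 2 := by
    have hmax := hρ_max 1 2 2 (by decide)
    generalize ρstar 1 2 = r at hmax ⊢
    fin_cases r
    iterate 2
      · simp [F2] at hmax
        linarith
    · rfl
  obtain ⟨hf, hg⟩ := max_lt_iff.mp cii2
  refine ⟨fun τ hτ => ?_, ⟨fun τ hτ hτ' => ?_, ?_⟩, fun τ => ?_, fun ρ => ?_⟩
  · fin_cases τ
    · simpa [V00, V02, F1] using hf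
    · simpa [V01, V02, F1] using hg
    · exact absurd rfl hτ
  · fin_cases τ
    · simp at hτ
    · exact absurd rfl hτ'
    · simpa [V11, V12, F1] using cii1
  · simpa [V00, V01, F1] using ciii
  · fin_cases τ <;> simp [F1, civ.le]
  · fin_cases ρ <;> simp [F2] <;> linarith

end

end Stmt1
end

section
/- Define V_C : [0,1] → ℝ by V_C(P1) = 2 if P1 ≥ 1/2 and V_C(P1) = 4 + P1 if P1 < 1/2, and define V : [0,1]² → ℝ by V(P0,P1) = 3·P0 + (1 − P0)·V_C(P1). Then the supremum of V over [0,1]² equals 9/2, and V(P0,P1) < 9/2 for every (P0,P1) ∈ [0,1]². Hence the supremum is not attained: an optimal randomized precommitment strategy does not exist. -/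
namespace Stmt2

noncomputable section

/-- Leader's continuation value as a function of the time-1 stopping probability. -/
def VC (P1 : ℝ) : ℝ := if P1 ≥ 1/2 then 2 else 4 + P1

/-- Leader's expected payoff under the randomized policy `(P0, P1)`. -/
def V (P0 P1 : ℝ) : ℝ := 3 * P0 + (1 - P0) * VC P1

theorem VC_lt {p : ℝ} : VC p < 9/2 := by
  unfold VC
  split_ifs <;> linarith

theorem V_lt {p q : ℝ} (hp : p ∈ Set.Icc (0:ℝ) 1) : V p q < 9/2 := by
  have hc : VC q < 9/2 := VC_lt
  have h : (1 - p) * VC q ≤ (1 - p) * (9/2) :=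
    mul_le_mul_of_nonneg_left hc.le (sub_nonneg.2 hp.2)
  unfold V
  rcases hp.1.eq_or_lt with rfl | h0
  · linarith
  · linarith

theorem V_zero_of_lt {q : ℝ} (hq : q < 1/2) : V 0 q = 4 + q := by
  simp only [V, VC, if_neg (not_le.2 hq)]
  ring

theorem isLUB_V :
    IsLUB {v : ℝ | ∃ P0 ∈ Set.Icc (0:ℝ) 1, ∃ P1 ∈ Set.Icc (0:ℝ) 1, v = V P0 P1} (9/2) := by
  refine ⟨?_, fun b hb => le_of_forall_lt fun c hc => ?_⟩
  · rintro v ⟨p, hp, q, -, rfl⟩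
    exact (V_lt hp).le
  · obtain ⟨q, hq, hq'⟩ := exists_between (show max 0 (c - 4) < 1/2 by
      rw [max_lt_iff]; constructor <;> linarith)
    rw [max_lt_iff] at hq
    have hqb : V 0 q ≤ b :=
      hb ⟨0, ⟨le_rfl, zero_le_one⟩, q, ⟨hq.1.le, by linarith⟩, rfl⟩
    rw [V_zero_of_lt hq'] at hqb
    linarith

/-- The supremum of `V` over `[0,1]²` equals `9/2`, but `V < 9/2` everywhere on `[0,1]²`:
an optimal randomized precommitment strategy does not exist. -/
theorem precommit_random_nonexist :
    sSup {v : ℝ | ∃ P0 ∈ Set.Icc (0:ℝ) 1, ∃ P1 ∈ Set.Icc (0:ℝ) 1, v = V P0 P1} = 9/2 ∧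
    ∀ P0 ∈ Set.Icc (0:ℝ) 1, ∀ P1 ∈ Set.Icc (0:ℝ) 1, V P0 P1 < 9/2 :=
  ⟨isLUB_V.csSup_eq ⟨V 0 0, 0, by simp, 0, by simp, rfl⟩, fun _ hp _ _ => V_lt hp⟩

end

end Stmt2
end

section
/- Each of the two Bellman systems w(x) = Φ̲[w](x) for all x ∈ Fin N, and w(x) = Φ̄[w](x) for all x ∈ Fin N, admits exactly one solution w : Fin N → ℝ. (These unique solutions are the infimum value w̲ and the supremum value w̄ of the follower's continuation value over the leader's randomized stopping policies.) -/
namespace Stmt6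

noncomputable section

/-- The cube `[0,1]^N` of randomized Markov stopping policies. -/
def cube (N : ℕ) : Set (Fin N → ℝ) := {p | ∀ y, p y ∈ Set.Icc (0:ℝ) 1}

/-- The follower's stopping value `W_S(y) = max{h2(y), g2(y)}`. -/
def WS {N : ℕ} (g2 h2 : Fin N → ℝ) (y : Fin N) : ℝ := max (h2 y) (g2 y)

/-- The follower's Bellman operator under the leader's Markov policy `p`. -/
def Phi (N : ℕ) (π : Fin N → Fin N → ℝ) (δ : ℝ) (f2 g2 h2 : Fin N → ℝ)
    (p w : Fin N → ℝ) (x : Fin N) : ℝ :=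
  max (f2 x) (δ * ∑ y, π x y * (p y * WS g2 h2 y + (1 - p y) * w y))

/-- The infimum Bellman operator `Φ̲[w](x) = inf_{p ∈ [0,1]^N} Φ_p[w](x)`. -/
def PhiLow (N : ℕ) (π : Fin N → Fin N → ℝ) (δ : ℝ) (f2 g2 h2 : Fin N → ℝ)
    (w : Fin N → ℝ) (x : Fin N) : ℝ :=
  sInf {v : ℝ | ∃ p ∈ cube N, v = Phi N π δ f2 g2 h2 p w x}

/-- The supremum Bellman operator `Φ̄[w](x) = sup_{p ∈ [0,1]^N} Φ_p[w](x)`. -/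
def PhiHigh (N : ℕ) (π : Fin N → Fin N → ℝ) (δ : ℝ) (f2 g2 h2 : Fin N → ℝ)
    (w : Fin N → ℝ) (x : Fin N) : ℝ :=
  sSup {v : ℝ | ∃ p ∈ cube N, v = Phi N π δ f2 g2 h2 p w x}

/-- A self-map of `ι → ℝ` satisfying a one-sided contraction estimate has a unique fixed point. -/
theorem existsUnique_fixedPoint_of_le_add {ι : Type*} [Fintype ι] (T : (ι → ℝ) → ι → ℝ) {δ : ℝ}
    (hδ0 : 0 ≤ δ) (hδ1 : δ < 1) (hT : ∀ w v x, T w x ≤ T v x + δ * dist w v) :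
    ∃! w : ι → ℝ, ∀ x, w x = T w x := by
  have hc : ContractingWith ⟨δ, hδ0⟩ T := by
    refine ⟨by exact_mod_cast hδ1, LipschitzWith.of_dist_le_mul fun w v => ?_⟩
    refine (dist_pi_le_iff (mul_nonneg hδ0 dist_nonneg)).2 fun x => ?_
    have h₁ := hT w v x
    have h₂ := hT v w x
    rw [dist_comm v w] at h₂
    rw [Real.dist_eq, abs_le]
    constructor <;> linarith
  refine ⟨ContractingWith.fixedPoint T hc, fun x => ?_, fun w hw => ?_⟩
  · exact (congrFun hc.fixedPoint_isFixedPt x).symm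
  · exact hc.fixedPoint_unique (funext fun x => (hw x).symm)

section Bellman

variable {N : ℕ} {π : Fin N → Fin N → ℝ} {δ : ℝ} {f2 g2 h2 : Fin N → ℝ}

theorem Phi_le_add_dist (hπ0 : ∀ x y, 0 ≤ π x y) (hπ1 : ∀ x, ∑ y, π x y = 1) (hδ : 0 ≤ δ)
    {p : Fin N → ℝ} (hp : p ∈ cube N) (w v : Fin N → ℝ) (x : Fin N) :
    Phi N π δ f2 g2 h2 p w x ≤ Phi N π δ f2 g2 h2 p v x + δ * dist w v := by
  have hsum : ∑ y, π x y * (p y * WS g2 h2 y + (1 - p y) * w y) ≤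
      ∑ y, π x y * (p y * WS g2 h2 y + (1 - p y) * v y) + dist w v := by
    calc _ ≤ ∑ y, (π x y * (p y * WS g2 h2 y + (1 - p y) * v y) + π x y * dist w v) := by
          refine Finset.sum_le_sum fun y _ => ?_
          rw [← mul_add]
          refine mul_le_mul_of_nonneg_left ?_ (hπ0 x y)
          have hy : w y - v y ≤ dist w v :=
            (le_abs_self _).trans ((Real.dist_eq _ _).symm.le.trans (dist_le_pi_dist w v y))
          have hd : 0 ≤ dist w v := dist_nonneg
          nlinarith [(hp y).1, (hp y).2]
      _ = _ := by rw [Finset.sum_add_distrib, ← Finset.sum_mul, hπ1, one_mul]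
  have hmul := mul_le_mul_of_nonneg_left hsum hδ
  have hd : 0 ≤ δ * dist w v := mul_nonneg hδ dist_nonneg
  refine max_le ?_ ?_
  · exact (le_max_left _ _).trans (le_add_of_nonneg_right hd)
  · rw [mul_add] at hmul
    exact hmul.trans (add_le_add_left (le_max_right _ _) _)

theorem bddBelow_Phi (w : Fin N → ℝ) (x : Fin N) :
    BddBelow {v : ℝ | ∃ p ∈ cube N, v = Phi N π δ f2 g2 h2 p w x} := by
  refine ⟨f2 x, ?_⟩
  rintro _ ⟨p, -, rfl⟩
  exact le_max_left _ _

theorem bddAbove_Phi (hπ0 : ∀ x y, 0 ≤ π x y) (hδ : 0 ≤ δ) (w : Fin N → ℝ) (x : Fin N) :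
    BddAbove {v : ℝ | ∃ p ∈ cube N, v = Phi N π δ f2 g2 h2 p w x} := by
  refine ⟨max (f2 x) (δ * ∑ y, π x y * max (WS g2 h2 y) (w y)), ?_⟩
  rintro _ ⟨p, hp, rfl⟩
  refine max_le_max le_rfl (mul_le_mul_of_nonneg_left (Finset.sum_le_sum fun y _ => ?_) hδ)
  refine mul_le_mul_of_nonneg_left ?_ (hπ0 x y)
  have h₁ := mul_le_mul_of_nonneg_left (le_max_left (WS g2 h2 y) (w y)) (hp y).1
  have h₂ := mul_le_mul_of_nonneg_left (le_max_right (WS g2 h2 y) (w y))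
    (sub_nonneg.2 (hp y).2)
  linarith

theorem nonempty_Phi (w : Fin N → ℝ) (x : Fin N) :
    {v : ℝ | ∃ p ∈ cube N, v = Phi N π δ f2 g2 h2 p w x}.Nonempty :=
  ⟨_, 0, fun _ => ⟨le_rfl, zero_le_one⟩, rfl⟩

theorem PhiLow_le_add_dist (hπ0 : ∀ x y, 0 ≤ π x y) (hπ1 : ∀ x, ∑ y, π x y = 1) (hδ : 0 ≤ δ)
    (w v : Fin N → ℝ) (x : Fin N) :
    PhiLow N π δ f2 g2 h2 w x ≤ PhiLow N π δ f2 g2 h2 v x + δ * dist w v := by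
  rw [← sub_le_iff_le_add]
  refine le_csInf (nonempty_Phi v x) ?_
  rintro _ ⟨p, hp, rfl⟩
  rw [sub_le_iff_le_add]
  exact (csInf_le (bddBelow_Phi w x) ⟨p, hp, rfl⟩).trans (Phi_le_add_dist hπ0 hπ1 hδ hp w v x)

theorem PhiHigh_le_add_dist (hπ0 : ∀ x y, 0 ≤ π x y) (hπ1 : ∀ x, ∑ y, π x y = 1) (hδ : 0 ≤ δ)
    (w v : Fin N → ℝ) (x : Fin N) :
    PhiHigh N π δ f2 g2 h2 w x ≤ PhiHigh N π δ f2 g2 h2 v x + δ * dist w v := by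
  refine csSup_le (nonempty_Phi w x) ?_
  rintro _ ⟨p, hp, rfl⟩
  have h := le_csSup (bddAbove_Phi (f2 := f2) (g2 := g2) (h2 := h2) hπ0 hδ v x) ⟨p, hp, rfl⟩
  exact (Phi_le_add_dist hπ0 hπ1 hδ hp w v x).trans (add_le_add_left h _)

end Bellman

/-- Each of the Bellman systems `w = Φ̲[w]` and `w = Φ̄[w]` admits exactly one
solution `w : Fin N → ℝ` (the infimum value `w̲` and the supremum value `w̄` of the
follower's continuation value over the leader's randomized stopping policies). -/
theorem bellman_unique_solutions (N : ℕ) (hN : 1 ≤ N)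
    (π : Fin N → Fin N → ℝ) (hπ0 : ∀ x y, 0 ≤ π x y) (hπ1 : ∀ x, ∑ y, π x y = 1)
    (δ : ℝ) (hδ : δ ∈ Set.Ioo (0:ℝ) 1) (f2 g2 h2 : Fin N → ℝ) :
    (∃! w : Fin N → ℝ, ∀ x, w x = PhiLow N π δ f2 g2 h2 w x) ∧
    (∃! w : Fin N → ℝ, ∀ x, w x = PhiHigh N π δ f2 g2 h2 w x) := by
  exact ⟨existsUnique_fixedPoint_of_le_add _ hδ.1.le hδ.2 (PhiLow_le_add_dist hπ0 hπ1 hδ.1.le),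
    existsUnique_fixedPoint_of_le_add _ hδ.1.le hδ.2 (PhiHigh_le_add_dist hπ0 hπ1 hδ.1.le)⟩

end

end Stmt6
end

section
/- Suppose w̲ : Fin N → ℝ satisfies w̲(x) = Φ̲[w̲](x) for all x ∈ Fin N. Define the pure Markov policy p̲ ∈ {0,1}^N by p̲(y) = 0 if W_S(y) ≥ w̲(y) and p̲(y) = 1 if W_S(y) < w̲(y). Then p̲ attains the infimum simultaneously in every component: w̲(x) = Φ_{p̲}[w̲](x) = max{f2(x), δ·Σ_y π(x,y)·(p̲(y)·W_S(y) + (1 − p̲(y))·w̲(y))} for all x ∈ Fin N. -/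
namespace Stmt7

noncomputable section

/-- The cube `[0,1]^N` of randomized Markov stopping policies. -/
def cube (N : ℕ) : Set (Fin N → ℝ) := {p | ∀ y, p y ∈ Set.Icc (0:ℝ) 1}

/-- The follower's stopping value `W_S(y) = max{h2(y), g2(y)}`. -/
def WS {N : ℕ} (g2 h2 : Fin N → ℝ) (y : Fin N) : ℝ := max (h2 y) (g2 y)

/-- The follower's Bellman operator under the leader's Markov policy `p`. -/
def Phi (N : ℕ) (π : Fin N → Fin N → ℝ) (δ : ℝ) (f2 g2 h2 : Fin N → ℝ)
    (p w : Fin N → ℝ) (x : Fin N) : ℝ :=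
  max (f2 x) (δ * ∑ y, π x y * (p y * WS g2 h2 y + (1 - p y) * w y))

/-- The infimum Bellman operator `Φ̲[w](x) = inf_{p ∈ [0,1]^N} Φ_p[w](x)`. -/
def PhiLow (N : ℕ) (π : Fin N → Fin N → ℝ) (δ : ℝ) (f2 g2 h2 : Fin N → ℝ)
    (w : Fin N → ℝ) (x : Fin N) : ℝ :=
  sInf {v : ℝ | ∃ p ∈ cube N, v = Phi N π δ f2 g2 h2 p w x}

/-- The supremum Bellman operator `Φ̄[w](x) = sup_{p ∈ [0,1]^N} Φ_p[w](x)`. -/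
def PhiHigh (N : ℕ) (π : Fin N → Fin N → ℝ) (δ : ℝ) (f2 g2 h2 : Fin N → ℝ)
    (w : Fin N → ℝ) (x : Fin N) : ℝ :=
  sSup {v : ℝ | ∃ p ∈ cube N, v = Phi N π δ f2 g2 h2 p w x}

/-- The pure policy that stops exactly where `W_S < w` minimizes `Φ_p[w](x)` over the cube. -/
theorem Phi_pure_le {N : ℕ} {π : Fin N → Fin N → ℝ} (hπ0 : ∀ x y, 0 ≤ π x y)
    {δ : ℝ} (hδ : 0 ≤ δ) (f2 g2 h2 w : Fin N → ℝ) {p : Fin N → ℝ} (hp : p ∈ cube N)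
    (x : Fin N) :
    Phi N π δ f2 g2 h2 (fun y => if w y ≤ WS g2 h2 y then (0:ℝ) else 1) w x ≤
      Phi N π δ f2 g2 h2 p w x := by
  refine max_le_max le_rfl (mul_le_mul_of_nonneg_left
    (Finset.sum_le_sum fun y _ => mul_le_mul_of_nonneg_left ?_ (hπ0 x y)) hδ)
  obtain ⟨h0, h1⟩ := hp y
  dsimp only
  split_ifs with h
  · nlinarith [mul_nonneg h0 (sub_nonneg.2 h)]
  · nlinarith [mul_nonneg (sub_nonneg.2 h1) (sub_nonneg.2 (not_le.1 h).le)]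

/-- If `w̲` solves `w̲ = Φ̲[w̲]`, then the pure Markov policy
`p̲(y) = 0` if `W_S(y) ≥ w̲(y)` and `p̲(y) = 1` if `W_S(y) < w̲(y)` attains the
infimum simultaneously in every component: `w̲(x) = Φ_{p̲}[w̲](x)` for all `x`. -/
theorem pure_policy_attains_infimum (N : ℕ) (hN : 1 ≤ N)
    (π : Fin N → Fin N → ℝ) (hπ0 : ∀ x y, 0 ≤ π x y) (hπ1 : ∀ x, ∑ y, π x y = 1)
    (δ : ℝ) (hδ : δ ∈ Set.Ioo (0:ℝ) 1) (f2 g2 h2 : Fin N → ℝ)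
    (wlow : Fin N → ℝ) (hfix : ∀ x, wlow x = PhiLow N π δ f2 g2 h2 wlow x) :
    ∀ x, wlow x =
      Phi N π δ f2 g2 h2 (fun y => if wlow y ≤ WS g2 h2 y then (0:ℝ) else 1) wlow x := by
  intro x
  rw [hfix x]
  refine IsLeast.csInf_eq ⟨⟨_, ?_, rfl⟩, ?_⟩
  · intro y
    beta_reduce
    split_ifs <;> simp
  · rintro _ ⟨p, hp, rfl⟩
    exact Phi_pure_le hπ0 hδ.1.le f2 g2 h2 wlow hp x

end

end Stmt7
end

section
/- Let p ∈ [0,1]^N and let w̲, w̄, w_p : Fin N → ℝ satisfy w̲(x) = Φ̲[w̲](x), w̄(x) = Φ̄[w̄](x) and w_p(x) = Φ_p[w_p](x) for all x ∈ Fin N. Then w̲(x) ≤ w_p(x) ≤ w̄(x) for every x ∈ Fin N; i.e. the follower's continuation value under any Markov policy lies between the unique fixed points of the infimum and supremum Bellman operators. -/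
namespace Stmt9

noncomputable section

/-- The cube `[0,1]^N` of randomized Markov stopping policies. -/
def cube (N : ℕ) : Set (Fin N → ℝ) := {p | ∀ y, p y ∈ Set.Icc (0:ℝ) 1}

/-- The follower's stopping value `W_S(y) = max{h2(y), g2(y)}`. -/
def WS {N : ℕ} (g2 h2 : Fin N → ℝ) (y : Fin N) : ℝ := max (h2 y) (g2 y)

/-- The follower's Bellman operator under the leader's Markov policy `p`. -/
def Phi (N : ℕ) (π : Fin N → Fin N → ℝ) (δ : ℝ) (f2 g2 h2 : Fin N → ℝ)
    (p w : Fin N → ℝ) (x : Fin N) : ℝ :=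
  max (f2 x) (δ * ∑ y, π x y * (p y * WS g2 h2 y + (1 - p y) * w y))

/-- The infimum Bellman operator `Φ̲[w](x) = inf_{p ∈ [0,1]^N} Φ_p[w](x)`. -/
def PhiLow (N : ℕ) (π : Fin N → Fin N → ℝ) (δ : ℝ) (f2 g2 h2 : Fin N → ℝ)
    (w : Fin N → ℝ) (x : Fin N) : ℝ :=
  sInf {v : ℝ | ∃ p ∈ cube N, v = Phi N π δ f2 g2 h2 p w x}

/-- The supremum Bellman operator `Φ̄[w](x) = sup_{p ∈ [0,1]^N} Φ_p[w](x)`. -/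
def PhiHigh (N : ℕ) (π : Fin N → Fin N → ℝ) (δ : ℝ) (f2 g2 h2 : Fin N → ℝ)
    (w : Fin N → ℝ) (x : Fin N) : ℝ :=
  sSup {v : ℝ | ∃ p ∈ cube N, v = Phi N π δ f2 g2 h2 p w x}

/-- A one-sided contraction estimate for `Phi`. -/
theorem Phi_le_Phi_add {N : ℕ} {π : Fin N → Fin N → ℝ} (hπ0 : ∀ x y, 0 ≤ π x y)
    (hπ1 : ∀ x, ∑ y, π x y = 1) {δ : ℝ} (hδ : 0 ≤ δ) (f2 g2 h2 : Fin N → ℝ)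
    {p : Fin N → ℝ} (hp : p ∈ cube N) {u v : Fin N → ℝ} {M : ℝ} (hM : 0 ≤ M)
    (h : ∀ y, u y ≤ v y + M) (x : Fin N) :
    Phi N π δ f2 g2 h2 p u x ≤ Phi N π δ f2 g2 h2 p v x + δ * M := by
  have hsum : ∑ y, π x y * (p y * WS g2 h2 y + (1 - p y) * u y) ≤
      ∑ y, π x y * (p y * WS g2 h2 y + (1 - p y) * v y) + M := by
    calc
      _ ≤ ∑ y, (π x y * (p y * WS g2 h2 y + (1 - p y) * v y) + π x y * M) := by
        refine Finset.sum_le_sum fun y _ => ?_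
        rw [← mul_add]
        refine mul_le_mul_of_nonneg_left ?_ (hπ0 x y)
        have h1 := mul_le_mul_of_nonneg_left (h y) (sub_nonneg.2 (hp y).2)
        have h2 := mul_nonneg (hp y).1 hM
        linarith
      _ = _ := by rw [Finset.sum_add_distrib, ← Finset.sum_mul, hπ1, one_mul]
  refine max_le ?_ ?_
  · exact (le_max_left _ _).trans (le_add_of_nonneg_right (mul_nonneg hδ hM))
  · have h1 := mul_le_mul_of_nonneg_left hsum hδ
    rw [mul_add] at h1
    exact h1.trans (add_le_add_left (le_max_right _ _) _)

/-- Comparison principle: a subsolution of `Phi` lies below a supersolution. -/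
theorem le_of_le_Phi_of_Phi_le {N : ℕ} {π : Fin N → Fin N → ℝ} (hπ0 : ∀ x y, 0 ≤ π x y)
    (hπ1 : ∀ x, ∑ y, π x y = 1) {δ : ℝ} (hδ : δ ∈ Set.Ioo (0:ℝ) 1) {f2 g2 h2 : Fin N → ℝ}
    {p : Fin N → ℝ} (hp : p ∈ cube N) {u v : Fin N → ℝ}
    (hu : ∀ x, u x ≤ Phi N π δ f2 g2 h2 p u x) (hv : ∀ x, Phi N π δ f2 g2 h2 p v x ≤ v x)
    (x : Fin N) : u x ≤ v x := by
  have : Nonempty (Fin N) := ⟨x⟩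
  obtain ⟨z, hz⟩ := Finite.exists_max fun y => u y - v y
  by_contra! hx
  have hM : 0 < u z - v z := (sub_pos.2 hx).trans_le (hz x)
  have h := Phi_le_Phi_add hπ0 hπ1 hδ.1.le f2 g2 h2 hp (u := u) (v := v) hM.le
    (fun y => by linarith [hz y]) z
  have := mul_lt_mul_of_pos_right hδ.2 hM
  linarith [hu z, hv z]

theorem bddBelow_Phi (N : ℕ) (π : Fin N → Fin N → ℝ) (δ : ℝ) (f2 g2 h2 w : Fin N → ℝ)
    (x : Fin N) : BddBelow {v : ℝ | ∃ p ∈ cube N, v = Phi N π δ f2 g2 h2 p w x} := by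
  refine ⟨f2 x, ?_⟩
  rintro _ ⟨p, -, rfl⟩
  exact le_max_left _ _

theorem bddAbove_Phi {N : ℕ} {π : Fin N → Fin N → ℝ} (hπ0 : ∀ x y, 0 ≤ π x y) {δ : ℝ}
    (hδ : 0 ≤ δ) (f2 g2 h2 w : Fin N → ℝ) (x : Fin N) :
    BddAbove {v : ℝ | ∃ p ∈ cube N, v = Phi N π δ f2 g2 h2 p w x} := by
  refine ⟨max (f2 x) (δ * ∑ y, π x y * max (WS g2 h2 y) (w y)), ?_⟩
  rintro _ ⟨p, hp, rfl⟩
  refine max_le_max le_rfl (mul_le_mul_of_nonneg_left (Finset.sum_le_sum fun y _ =>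
    mul_le_mul_of_nonneg_left ?_ (hπ0 x y)) hδ)
  have h1 := mul_le_mul_of_nonneg_left (le_max_left (WS g2 h2 y) (w y)) (hp y).1
  have h2 := mul_le_mul_of_nonneg_left (le_max_right (WS g2 h2 y) (w y)) (sub_nonneg.2 (hp y).2)
  linarith

/-- The follower's continuation value under any Markov policy `p ∈ [0,1]^N` lies
between the fixed points of the infimum and supremum Bellman operators. -/
theorem fixed_point_sandwich (N : ℕ) (hN : 1 ≤ N)
    (π : Fin N → Fin N → ℝ) (hπ0 : ∀ x y, 0 ≤ π x y) (hπ1 : ∀ x, ∑ y, π x y = 1)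
    (δ : ℝ) (hδ : δ ∈ Set.Ioo (0:ℝ) 1) (f2 g2 h2 : Fin N → ℝ)
    (p : Fin N → ℝ) (hp : p ∈ cube N)
    (wlow whigh wp : Fin N → ℝ)
    (hlow : ∀ x, wlow x = PhiLow N π δ f2 g2 h2 wlow x)
    (hhigh : ∀ x, whigh x = PhiHigh N π δ f2 g2 h2 whigh x)
    (hwp : ∀ x, wp x = Phi N π δ f2 g2 h2 p wp x) :
    ∀ x, wlow x ≤ wp x ∧ wp x ≤ whigh x := by
  refine fun x => ⟨?_, ?_⟩
  · refine le_of_le_Phi_of_Phi_le hπ0 hπ1 hδ hp (fun y => ?_) (fun y => (hwp y).ge) x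
    exact (hlow y).le.trans (csInf_le (bddBelow_Phi N π δ f2 g2 h2 wlow y) ⟨p, hp, rfl⟩)
  · refine le_of_le_Phi_of_Phi_le hπ0 hπ1 hδ hp (fun y => (hwp y).le) (fun y => ?_) x
    exact (le_csSup (bddAbove_Phi hπ0 hδ.1.le f2 g2 h2 whigh y) ⟨p, hp, rfl⟩).trans (hhigh y).ge

end

end Stmt9
end

section
/- Suppose u, v : Fin N → ℝ → ℝ are bounded, and let C ≥ 0 satisfy |u(y,s) − v(y,s)| ≤ C for all y ∈ Fin N and all s ∈ [a(y), b(y)]. Then |T[u](x,w) − T[v](x,w)| ≤ β·C for all x ∈ Fin N and all w ∈ ℝ; that is, the Bellman operator T of the leader's precommitment value is a β-contraction on the space of bounded functions with the supremum norm. -/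
namespace Stmt10

noncomputable section

/-- Update rule for the follower's continuation value:
`Θ_x(w',p) = δ·Σ_y π(x,y)·(p(y)·W_S(y) + (1−p(y))·w'(y))`. -/
def Theta (N : ℕ) (π : Fin N → Fin N → ℝ) (δ : ℝ) (WS : Fin N → ℝ)
    (x : Fin N) (w' p : Fin N → ℝ) : ℝ :=
  δ * ∑ y, π x y * (p y * WS y + (1 - p y) * w' y)

/-- The Bellman operator `T` of the leader's precommitment value, acting on
functions `u : Fin N → ℝ → ℝ`.  For `w > f2 x` the supremum is over the
admissible set `A(x,w)`; recall `sSup ∅ = 0` in `ℝ`, matching the convention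
`sup ∅ := 0`. -/
def T (N : ℕ) (π : Fin N → Fin N → ℝ) (δ β : ℝ) (f2 WS VS g1 a b : Fin N → ℝ)
    (u : Fin N → ℝ → ℝ) (x : Fin N) (w : ℝ) : ℝ :=
  if w = f2 x then g1 x
  else if f2 x < w then
    sSup {v : ℝ | ∃ w' p : Fin N → ℝ,
      (∀ y, w' y ∈ Set.Icc (a y) (b y)) ∧ (∀ y, p y ∈ Set.Icc (0:ℝ) 1) ∧
      Theta N π δ WS x w' p = w ∧
      v = β * ∑ y, π x y * (p y * VS y + (1 - p y) * u y (w' y))}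
  else 0

/-- The payoffs over which `T` takes its supremum are bounded above when `v` is bounded. -/
theorem bddAbove_payoffs {N : ℕ} {π : Fin N → Fin N → ℝ} (hπ0 : ∀ x y, 0 ≤ π x y)
    {δ β : ℝ} (hβ : 0 ≤ β) {WS VS a b : Fin N → ℝ} {v : Fin N → ℝ → ℝ}
    (hv : ∃ M : ℝ, ∀ y s, |v y s| ≤ M) (x : Fin N) (w : ℝ) :
    BddAbove {r : ℝ | ∃ w' p : Fin N → ℝ,
      (∀ y, w' y ∈ Set.Icc (a y) (b y)) ∧ (∀ y, p y ∈ Set.Icc (0:ℝ) 1) ∧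
      Theta N π δ WS x w' p = w ∧
      r = β * ∑ y, π x y * (p y * VS y + (1 - p y) * v y (w' y))} := by
  obtain ⟨M, hM⟩ := hv
  refine ⟨β * ∑ y, π x y * (|VS y| + M), ?_⟩
  rintro _ ⟨w', p, -, hp, -, rfl⟩
  refine mul_le_mul_of_nonneg_left (Finset.sum_le_sum fun y _ =>
    mul_le_mul_of_nonneg_left ?_ (hπ0 x y)) hβ
  obtain ⟨h0, h1⟩ := hp y
  have hM0 : 0 ≤ M := (abs_nonneg _).trans (hM y 0)
  have hvM := (le_abs_self _).trans (hM y (w' y))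
  have hVS := mul_le_mul_of_nonneg_left (le_abs_self (VS y)) h0
  have hVS' := mul_le_of_le_one_left (abs_nonneg (VS y)) h1
  have hvM' := mul_le_mul_of_nonneg_left hvM (sub_nonneg.2 h1)
  have hM' := mul_nonneg h0 hM0
  linarith

/-- Monotonicity and discounting: if `u ≤ v + C` on the intervals, then `T u ≤ T v + β * C`. -/
theorem T_le_T_add {N : ℕ} {π : Fin N → Fin N → ℝ} (hπ0 : ∀ x y, 0 ≤ π x y)
    (hπ1 : ∀ x, ∑ y, π x y = 1) {δ β : ℝ} (hβ : 0 ≤ β)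
    {f2 WS VS g1 a b : Fin N → ℝ} {u v : Fin N → ℝ → ℝ}
    (hv : ∃ M : ℝ, ∀ y s, |v y s| ≤ M) {C : ℝ} (hC : 0 ≤ C)
    (huv : ∀ y, ∀ s ∈ Set.Icc (a y) (b y), u y s ≤ v y s + C) (x : Fin N) (w : ℝ) :
    T N π δ β f2 WS VS g1 a b u x w ≤ T N π δ β f2 WS VS g1 a b v x w + β * C := by
  have hβC := mul_nonneg hβ hC
  unfold T
  split_ifs
  · linarith
  · by_cases hne : ∃ w' p : Fin N → ℝ, (∀ y, w' y ∈ Set.Icc (a y) (b y)) ∧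
        (∀ y, p y ∈ Set.Icc (0:ℝ) 1) ∧ Theta N π δ WS x w' p = w
    · obtain ⟨w₀, p₀, hw₀, hp₀, hΘ₀⟩ := hne
      refine csSup_le ⟨_, w₀, p₀, hw₀, hp₀, hΘ₀, rfl⟩ ?_
      rintro _ ⟨w', p, hw', hp, hΘ, rfl⟩
      have hle := le_csSup (bddAbove_payoffs (VS := VS) hπ0 hβ hv x w)
        ⟨w', p, hw', hp, hΘ, rfl⟩
      refine le_trans ?_ (add_le_add_left hle _)
      rw [← mul_add]
      refine mul_le_mul_of_nonneg_left ?_ hβ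
      calc ∑ y, π x y * (p y * VS y + (1 - p y) * u y (w' y))
          ≤ ∑ y, (π x y * (p y * VS y + (1 - p y) * v y (w' y)) + π x y * C) := by
            refine Finset.sum_le_sum fun y _ => ?_
            rw [← mul_add]
            refine mul_le_mul_of_nonneg_left ?_ (hπ0 x y)
            obtain ⟨h0, h1⟩ := hp y
            have h := mul_le_mul_of_nonneg_left (huv y _ (hw' y)) (sub_nonneg.2 h1)
            have hpC := mul_nonneg h0 hC
            linarith
        _ = ∑ y, π x y * (p y * VS y + (1 - p y) * v y (w' y)) + C := by
            rw [Finset.sum_add_distrib, ← Finset.sum_mul, hπ1, one_mul]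
    · have hempty : ∀ z : Fin N → ℝ → ℝ, {r : ℝ | ∃ w' p : Fin N → ℝ,
          (∀ y, w' y ∈ Set.Icc (a y) (b y)) ∧ (∀ y, p y ∈ Set.Icc (0:ℝ) 1) ∧
          Theta N π δ WS x w' p = w ∧
          r = β * ∑ y, π x y * (p y * VS y + (1 - p y) * z y (w' y))} = ∅ := by
        intro z
        refine Set.eq_empty_of_forall_notMem ?_
        rintro _ ⟨w', p, hw', hp, hΘ, -⟩
        exact hne ⟨w', p, hw', hp, hΘ⟩
      rw [hempty u, hempty v]
      linarith
  · linarith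

/-- The Bellman operator `T` of the leader's precommitment value is a
`β`-contraction on the space of bounded functions with the supremum norm. -/
theorem T_contraction (N : ℕ) (hN : 1 ≤ N)
    (π : Fin N → Fin N → ℝ) (hπ0 : ∀ x y, 0 ≤ π x y) (hπ1 : ∀ x, ∑ y, π x y = 1)
    (δ β : ℝ) (hδ : δ ∈ Set.Ioo (0:ℝ) 1) (hβ : β ∈ Set.Ioo (0:ℝ) 1)
    (f2 WS VS g1 a b : Fin N → ℝ) (hab : ∀ y, a y ≤ b y)
    (u v : Fin N → ℝ → ℝ)
    (hu : ∃ M : ℝ, ∀ y s, |u y s| ≤ M) (hv : ∃ M : ℝ, ∀ y s, |v y s| ≤ M)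
    (C : ℝ) (hC : 0 ≤ C)
    (hclose : ∀ y, ∀ s ∈ Set.Icc (a y) (b y), |u y s - v y s| ≤ C) :
    ∀ (x : Fin N) (w : ℝ),
      |T N π δ β f2 WS VS g1 a b u x w - T N π δ β f2 WS VS g1 a b v x w| ≤ β * C := by
  intro x w
  have huv := T_le_T_add (δ := δ) (f2 := f2) (WS := WS) (VS := VS) (g1 := g1) (u := u) hπ0 hπ1
    hβ.1.le hv hC (fun y s hs => by linarith [(abs_le.1 (hclose y s hs)).2]) x w
  have hvu := T_le_T_add (δ := δ) (f2 := f2) (WS := WS) (VS := VS) (g1 := g1) (u := v) hπ0 hπ1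
    hβ.1.le hu hC (fun y s hs => by linarith [(abs_le.1 (hclose y s hs)).1]) x w
  rw [abs_le]
  constructor <;> linarith

end

end Stmt10
end

section
/- There exists exactly one bounded function u : Fin N → ℝ → ℝ satisfying the Bellman equation u(x,w) = T[u](x,w) for all x ∈ Fin N and all w ∈ ℝ. (This unique bounded solution is the leader's value v_x(w) as a function of the follower's continuation value w, which characterizes the optimal precommitment value of the leader.) -/
namespace Stmt11

noncomputable section

/-- Update rule for the follower's continuation value:
`Θ_x(w',p) = δ·Σ_y π(x,y)·(p(y)·W_S(y) + (1−p(y))·w'(y))`. -/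
def Theta (N : ℕ) (π : Fin N → Fin N → ℝ) (δ : ℝ) (WS : Fin N → ℝ)
    (x : Fin N) (w' p : Fin N → ℝ) : ℝ :=
  δ * ∑ y, π x y * (p y * WS y + (1 - p y) * w' y)

/-- The Bellman operator `T` of the leader's precommitment value, acting on
functions `u : Fin N → ℝ → ℝ`.  For `w > f2 x` the supremum is over the
admissible set `A(x,w)`; recall `sSup ∅ = 0` in `ℝ`, matching the convention
`sup ∅ := 0`. -/
def T (N : ℕ) (π : Fin N → Fin N → ℝ) (δ β : ℝ) (f2 WS VS g1 a b : Fin N → ℝ)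
    (u : Fin N → ℝ → ℝ) (x : Fin N) (w : ℝ) : ℝ :=
  if w = f2 x then g1 x
  else if f2 x < w then
    sSup {v : ℝ | ∃ w' p : Fin N → ℝ,
      (∀ y, w' y ∈ Set.Icc (a y) (b y)) ∧ (∀ y, p y ∈ Set.Icc (0:ℝ) 1) ∧
      Theta N π δ WS x w' p = w ∧
      v = β * ∑ y, π x y * (p y * VS y + (1 - p y) * u y (w' y))}
  else 0

/-- A self-map of functions `α → ℝ` that preserves boundedness and contracts the uniform distance
by a factor `c < 1` has exactly one bounded fixed point. -/
theorem existsUnique_bounded_fixedPoint {α : Type*} (F : (α → ℝ) → α → ℝ) {c : ℝ} (hc0 : 0 ≤ c)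
    (hc1 : c < 1) (hF : ∀ u M, (∀ x, |u x| ≤ M) → ∃ M', ∀ x, |F u x| ≤ M')
    (hcon : ∀ u v M C, (∀ x, |u x| ≤ M) → (∀ x, |v x| ≤ M) → 0 ≤ C → (∀ x, |u x - v x| ≤ C) →
      ∀ x, |F u x - F v x| ≤ c * C) :
    ∃! u : α → ℝ, (∃ M, ∀ x, |u x| ≤ M) ∧ ∀ x, u x = F u x := by
  let _ : TopologicalSpace α := ⊥
  have : DiscreteTopology α := ⟨rfl⟩
  have hbdd : ∀ u : BoundedContinuousFunction α ℝ, ∃ M', ∀ x, |F u x| ≤ M' := fun u =>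
    hF u ‖u‖ fun x => u.norm_coe_le_norm x
  choose B hB using hbdd
  let G : BoundedContinuousFunction α ℝ → BoundedContinuousFunction α ℝ := fun u =>
    BoundedContinuousFunction.ofNormedAddCommGroupDiscrete (F u) (B u) (hB u)
  have hG : ContractingWith ⟨c, hc0⟩ G := by
    refine ⟨hc1, LipschitzWith.of_dist_le_mul fun u v => ?_⟩
    refine (BoundedContinuousFunction.dist_le (mul_nonneg hc0 dist_nonneg)).2 fun x => ?_
    exact hcon u v (max ‖u‖ ‖v‖) (dist u v)
      (fun x => (u.norm_coe_le_norm x).trans (le_max_left _ _))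
      (fun x => (v.norm_coe_le_norm x).trans (le_max_right _ _)) dist_nonneg
      (fun x => BoundedContinuousFunction.dist_coe_le_dist (f := u) (g := v) x) x
  have hfix := hG.fixedPoint_isFixedPt
  refine ⟨hG.fixedPoint, ⟨⟨_, fun x => hG.fixedPoint.norm_coe_le_norm x⟩, fun x => ?_⟩, ?_⟩
  · exact (DFunLike.congr_fun hfix x).symm
  · rintro v ⟨⟨M, hM⟩, hv⟩
    let v' : BoundedContinuousFunction α ℝ :=
      BoundedContinuousFunction.ofNormedAddCommGroupDiscrete v M hM
    have hv' : Function.IsFixedPt G v' := DFunLike.ext _ _ fun x => (hv x).symm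
    funext x
    exact DFunLike.congr_fun (hG.fixedPoint_unique hv') x

theorem abs_sSup_le {S : Set ℝ} {B : ℝ} (hB : 0 ≤ B) (hS : ∀ s ∈ S, |s| ≤ B) : |sSup S| ≤ B := by
  rcases S.eq_empty_or_nonempty with rfl | ⟨s, hs⟩
  · simpa using hB
  · have hbdd : BddAbove S := ⟨B, fun t ht => (abs_le.1 (hS t ht)).2⟩
    exact abs_le.2 ⟨(abs_le.1 (hS s hs)).1.trans (le_csSup hbdd hs),
      Real.sSup_le (fun t ht => (abs_le.1 (hS t ht)).2) hB⟩

theorem abs_sSup_image_sub_le {ι : Type*} {A : Set ι} {f g : ι → ℝ} {c : ℝ} (hc : 0 ≤ c)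
    (hf : BddAbove (f '' A)) (hg : BddAbove (g '' A)) (h : ∀ i ∈ A, |f i - g i| ≤ c) :
    |sSup (f '' A) - sSup (g '' A)| ≤ c := by
  rcases A.eq_empty_or_nonempty with rfl | hA
  · simpa using hc
  · have h₁ : sSup (f '' A) ≤ sSup (g '' A) + c := by
      refine csSup_le (hA.image f) ?_
      rintro _ ⟨i, hi, rfl⟩
      linarith [(abs_le.1 (h i hi)).2, le_csSup hg (Set.mem_image_of_mem g hi)]
    have h₂ : sSup (g '' A) ≤ sSup (f '' A) + c := by
      refine csSup_le (hA.image g) ?_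
      rintro _ ⟨i, hi, rfl⟩
      linarith [(abs_le.1 (h i hi)).1, le_csSup hf (Set.mem_image_of_mem f hi)]
    exact abs_le.2 ⟨by linarith, by linarith⟩

theorem abs_sum_mul_le_of_sum_eq_one {ι : Type*} [Fintype ι] {q f : ι → ℝ} {C : ℝ}
    (hq0 : ∀ i, 0 ≤ q i) (hq1 : ∑ i, q i = 1) (hf : ∀ i, |f i| ≤ C) :
    |∑ i, q i * f i| ≤ C := by
  calc |∑ i, q i * f i| ≤ ∑ i, |q i * f i| := Finset.abs_sum_le_sum_abs _ _
    _ ≤ ∑ i, q i * C := Finset.sum_le_sum fun i _ => by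
        rw [abs_mul, abs_of_nonneg (hq0 i)]
        exact mul_le_mul_of_nonneg_left (hf i) (hq0 i)
    _ = C := by rw [← Finset.sum_mul, hq1, one_mul]

/-- The admissible set `A(x,w)` of pairs `(w', p)`. -/
def admissible (N : ℕ) (π : Fin N → Fin N → ℝ) (δ : ℝ) (WS a b : Fin N → ℝ) (x : Fin N) (w : ℝ) :
    Set ((Fin N → ℝ) × (Fin N → ℝ)) :=
  {z | (∀ y, z.1 y ∈ Set.Icc (a y) (b y)) ∧ (∀ y, z.2 y ∈ Set.Icc (0 : ℝ) 1) ∧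
    Theta N π δ WS x z.1 z.2 = w}

/-- The leader's discounted payoff from the choice `(w', p)` in state `x` when the continuation
payoffs are given by `u`. -/
def payoff (N : ℕ) (π : Fin N → Fin N → ℝ) (β : ℝ) (VS : Fin N → ℝ) (u : Fin N → ℝ → ℝ)
    (x : Fin N) (z : (Fin N → ℝ) × (Fin N → ℝ)) : ℝ :=
  β * ∑ y, π x y * (z.2 y * VS y + (1 - z.2 y) * u y (z.1 y))

theorem T_eq (N : ℕ) (π : Fin N → Fin N → ℝ) (δ β : ℝ) (f2 WS VS g1 a b : Fin N → ℝ)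
    (u : Fin N → ℝ → ℝ) (x : Fin N) (w : ℝ) :
    T N π δ β f2 WS VS g1 a b u x w =
      if w = f2 x then g1 x
      else if f2 x < w then sSup (payoff N π β VS u x '' admissible N π δ WS a b x w)
      else 0 := by
  unfold T
  congr 3
  ext v
  constructor
  · rintro ⟨w', p, hw, hp, hΘ, rfl⟩
    exact ⟨(w', p), ⟨hw, hp, hΘ⟩, rfl⟩
  · rintro ⟨⟨w', p⟩, ⟨hw, hp, hΘ⟩, rfl⟩
    exact ⟨w', p, hw, hp, hΘ, rfl⟩

section

variable {N : ℕ} {π : Fin N → Fin N → ℝ} {δ β : ℝ} {f2 WS VS g1 a b : Fin N → ℝ}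
  {u v : Fin N → ℝ → ℝ} {M K C : ℝ} {x : Fin N} {z : (Fin N → ℝ) × (Fin N → ℝ)}

theorem abs_payoff_le (hπ0 : ∀ x y, 0 ≤ π x y) (hπ1 : ∀ x, ∑ y, π x y = 1) (hβ : 0 ≤ β)
    (hu : ∀ x w, |u x w| ≤ M) (hV : ∀ y, |VS y| ≤ K) (hz : ∀ y, z.2 y ∈ Set.Icc (0 : ℝ) 1) :
    |payoff N π β VS u x z| ≤ β * max K M := by
  rw [payoff, abs_mul, abs_of_nonneg hβ]
  refine mul_le_mul_of_nonneg_left (abs_sum_mul_le_of_sum_eq_one (hπ0 x) (hπ1 x) fun y => ?_) hβ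
  obtain ⟨hp0, hp1⟩ := hz y
  have h₁ := abs_le.1 ((hV y).trans (le_max_left K M))
  have h₂ := abs_le.1 ((hu y (z.1 y)).trans (le_max_right K M))
  rw [abs_le]
  constructor <;> nlinarith

theorem abs_payoff_sub_le (hπ0 : ∀ x y, 0 ≤ π x y) (hπ1 : ∀ x, ∑ y, π x y = 1) (hβ : 0 ≤ β)
    (huv : ∀ x w, |u x w - v x w| ≤ C) (hz : ∀ y, z.2 y ∈ Set.Icc (0 : ℝ) 1) :
    |payoff N π β VS u x z - payoff N π β VS v x z| ≤ β * C := by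
  have hsub : payoff N π β VS u x z - payoff N π β VS v x z =
      β * ∑ y, π x y * ((1 - z.2 y) * (u y (z.1 y) - v y (z.1 y))) := by
    rw [payoff, payoff, ← mul_sub, ← Finset.sum_sub_distrib]
    congr 1
    exact Finset.sum_congr rfl fun y _ => by ring
  rw [hsub, abs_mul, abs_of_nonneg hβ]
  refine mul_le_mul_of_nonneg_left (abs_sum_mul_le_of_sum_eq_one (hπ0 x) (hπ1 x) fun y => ?_) hβ
  obtain ⟨hp0, hp1⟩ := hz y
  rw [abs_mul, abs_of_nonneg (sub_nonneg.2 hp1)]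
  nlinarith [huv y (z.1 y), abs_nonneg (u y (z.1 y) - v y (z.1 y))]

theorem exists_abs_T_le (hπ0 : ∀ x y, 0 ≤ π x y) (hπ1 : ∀ x, ∑ y, π x y = 1) (hβ : 0 ≤ β)
    (hu : ∀ x w, |u x w| ≤ M) :
    ∃ M', ∀ x w, |T N π δ β f2 WS VS g1 a b u x w| ≤ M' := by
  have hB : 0 ≤ β * max ‖VS‖ M := mul_nonneg hβ ((norm_nonneg VS).trans (le_max_left _ _))
  refine ⟨max ‖g1‖ (β * max ‖VS‖ M), fun x w => ?_⟩
  rw [T_eq]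
  split_ifs
  · exact (norm_le_pi_norm g1 x).trans (le_max_left _ _)
  · refine (abs_sSup_le hB ?_).trans (le_max_right _ _)
    rintro _ ⟨z, hz, rfl⟩
    exact abs_payoff_le hπ0 hπ1 hβ hu (norm_le_pi_norm VS) hz.2.1
  · simp

theorem abs_T_sub_le (hπ0 : ∀ x y, 0 ≤ π x y) (hπ1 : ∀ x, ∑ y, π x y = 1) (hβ : 0 ≤ β)
    (hC : 0 ≤ C) (hu : ∀ x w, |u x w| ≤ M) (hv : ∀ x w, |v x w| ≤ M)
    (huv : ∀ x w, |u x w - v x w| ≤ C) (x : Fin N) (w : ℝ) :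
    |T N π δ β f2 WS VS g1 a b u x w - T N π δ β f2 WS VS g1 a b v x w| ≤ β * C := by
  have hbdd : ∀ {u : Fin N → ℝ → ℝ}, (∀ x w, |u x w| ≤ M) →
      BddAbove (payoff N π β VS u x '' admissible N π δ WS a b x w) := by
    refine fun hu => ⟨β * max ‖VS‖ M, ?_⟩
    rintro _ ⟨z, hz, rfl⟩
    exact (le_abs_self _).trans (abs_payoff_le hπ0 hπ1 hβ hu (norm_le_pi_norm VS) hz.2.1)
  have hβC := mul_nonneg hβ hC
  rw [T_eq, T_eq]
  split_ifs
  · simpa using hβC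
  · exact abs_sSup_image_sub_le hβC (hbdd hu) (hbdd hv) fun z hz =>
      abs_payoff_sub_le hπ0 hπ1 hβ huv hz.2.1
  · simpa using hβC

end

/-- There is exactly one bounded function `u : Fin N → ℝ → ℝ` satisfying the
Bellman equation `u = T[u]`; it is the leader's value `v_x(w)` as a function of
the follower's continuation value `w`. -/
theorem T_unique_bounded_fixed_point (N : ℕ) (hN : 1 ≤ N)
    (π : Fin N → Fin N → ℝ) (hπ0 : ∀ x y, 0 ≤ π x y) (hπ1 : ∀ x, ∑ y, π x y = 1)
    (δ β : ℝ) (hδ : δ ∈ Set.Ioo (0:ℝ) 1) (hβ : β ∈ Set.Ioo (0:ℝ) 1)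
    (f2 WS VS g1 a b : Fin N → ℝ) (hab : ∀ y, a y ≤ b y) :
    ∃! u : Fin N → ℝ → ℝ,
      (∃ M : ℝ, ∀ x w, |u x w| ≤ M) ∧
      ∀ (x : Fin N) (w : ℝ), u x w = T N π δ β f2 WS VS g1 a b u x w := by
  obtain ⟨U, ⟨⟨M, hM⟩, hU⟩, huniq⟩ := existsUnique_bounded_fixedPoint
    (fun (U : Fin N × ℝ → ℝ) q => T N π δ β f2 WS VS g1 a b (Function.curry U) q.1 q.2)
    hβ.1.le hβ.2
    (fun U M hM =>
      let ⟨M', h⟩ := exists_abs_T_le hπ0 hπ1 hβ.1.le (u := Function.curry U) fun x w => hM (x, w)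
      ⟨M', fun q => h q.1 q.2⟩)
    (fun U V M C hM hM' hC hUV q => abs_T_sub_le hπ0 hπ1 hβ.1.le hC
      (u := Function.curry U) (v := Function.curry V) (fun x w => hM (x, w))
      (fun x w => hM' (x, w)) (fun x w => hUV (x, w)) q.1 q.2)
  refine ⟨Function.curry U, ⟨⟨M, fun x w => hM (x, w)⟩, fun x w => hU (x, w)⟩, ?_⟩
  rintro v ⟨⟨M', hM'⟩, hv⟩
  rw [← huniq (Function.uncurry v) ⟨⟨M', fun q => hM' q.1 q.2⟩, fun q => hv q.1 q.2⟩]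
  rfl

end

end Stmt11
end

section
/- For every p ∈ [0,1]^N, all w, w' : Fin N → ℝ, and every C ≥ 0 such that |w(y) − w'(y)| ≤ C for all y ∈ Fin N, one has |Φ^λ_p[w](x) − Φ^λ_p[w'](x)| ≤ δ·C for every x ∈ Fin N; that is, each entropy-regularized Bellman operator Φ^λ_p is a δ-contraction on ℝ^N with the supremum norm. -/
namespace Stmt13

noncomputable section

/-- The follower's regularized stopping value
`W_S^λ(y) = h2(y) + λ·log(1 + exp((g2(y) − h2(y))/λ))`. -/
def WSl (N : ℕ) (lam : ℝ) (g2 h2 : Fin N → ℝ) (y : Fin N) : ℝ :=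
  h2 y + lam * Real.log (1 + Real.exp ((g2 y - h2 y) / lam))

/-- The entropy-regularized Bellman operator `Φ^λ_p` under the leader's policy `p`. -/
def PhiLam (N : ℕ) (π : Fin N → Fin N → ℝ) (δ lam : ℝ) (f2 g2 h2 : Fin N → ℝ)
    (p w : Fin N → ℝ) (x : Fin N) : ℝ :=
  f2 x + lam * Real.log (1 + Real.exp
    ((δ * ∑ y, π x y * (p y * WSl N lam g2 h2 y + (1 - p y) * w y) - f2 x) / lam))

theorem log_one_add_exp_le_add_abs_sub (a b : ℝ) :
    Real.log (1 + Real.exp a) ≤ Real.log (1 + Real.exp b) + |a - b| := by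
  have hb : 0 < 1 + Real.exp b := by positivity
  rw [Real.log_le_iff_le_exp (by positivity), Real.exp_add, Real.exp_log hb, add_mul, one_mul,
    ← Real.exp_add]
  refine add_le_add (Real.one_le_exp (abs_nonneg _)) (Real.exp_le_exp.mpr ?_)
  linarith [le_abs_self (a - b)]

theorem abs_log_one_add_exp_sub_le (a b : ℝ) :
    |Real.log (1 + Real.exp a) - Real.log (1 + Real.exp b)| ≤ |a - b| := by
  rw [abs_sub_le_iff]
  have h₁ := log_one_add_exp_le_add_abs_sub a b
  have h₂ := log_one_add_exp_le_add_abs_sub b a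
  rw [abs_sub_comm b a] at h₂
  constructor <;> linarith

theorem abs_mul_log_one_add_exp_div_sub_le {lam : ℝ} (hlam : 0 < lam) (a b : ℝ) :
    |lam * Real.log (1 + Real.exp (a / lam)) - lam * Real.log (1 + Real.exp (b / lam))|
      ≤ |a - b| := by
  rw [← mul_sub, abs_mul, abs_of_pos hlam]
  calc lam * |Real.log (1 + Real.exp (a / lam)) - Real.log (1 + Real.exp (b / lam))|
      ≤ lam * |a / lam - b / lam| :=
        mul_le_mul_of_nonneg_left (abs_log_one_add_exp_sub_le _ _) hlam.le
    _ = |a - b| := by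
        rw [← sub_div, abs_div, abs_of_pos hlam, mul_div_cancel₀ _ hlam.ne']

theorem abs_sum_mul_sub_sum_mul_le {ι : Type*} [Fintype ι] {q u v : ι → ℝ} {C : ℝ}
    (hq0 : ∀ y, 0 ≤ q y) (hq1 : ∑ y, q y = 1) (huv : ∀ y, |u y - v y| ≤ C) :
    |∑ y, q y * u y - ∑ y, q y * v y| ≤ C := by
  rw [← Finset.sum_sub_distrib]
  calc |∑ y, (q y * u y - q y * v y)| ≤ ∑ y, |q y * u y - q y * v y| :=
        Finset.abs_sum_le_sum_abs _ _
    _ ≤ ∑ y, q y * C := by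
        refine Finset.sum_le_sum fun y _ => ?_
        rw [← mul_sub, abs_mul, abs_of_nonneg (hq0 y)]
        exact mul_le_mul_of_nonneg_left (huv y) (hq0 y)
    _ = C := by rw [← Finset.sum_mul, hq1, one_mul]

/-- Each entropy-regularized Bellman operator `Φ^λ_p` is a `δ`-contraction on
`ℝ^N` with the supremum norm. -/
theorem phiLam_contraction (N : ℕ) (hN : 1 ≤ N)
    (π : Fin N → Fin N → ℝ) (hπ0 : ∀ x y, 0 ≤ π x y) (hπ1 : ∀ x, ∑ y, π x y = 1)
    (δ lam : ℝ) (hδ : δ ∈ Set.Ioo (0:ℝ) 1) (hlam : 0 < lam)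
    (f2 g2 h2 : Fin N → ℝ)
    (p : Fin N → ℝ) (hp : ∀ y, p y ∈ Set.Icc (0:ℝ) 1)
    (w w' : Fin N → ℝ) (C : ℝ) (hC : 0 ≤ C) (hww' : ∀ y, |w y - w' y| ≤ C) :
    ∀ x : Fin N,
      |PhiLam N π δ lam f2 g2 h2 p w x - PhiLam N π δ lam f2 g2 h2 p w' x| ≤ δ * C := by
  intro x
  unfold PhiLam
  rw [add_sub_add_left_eq_sub]
  refine (abs_mul_log_one_add_exp_div_sub_le hlam _ _).trans ?_
  rw [sub_sub_sub_cancel_right, ← mul_sub, abs_mul, abs_of_pos hδ.1]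
  refine mul_le_mul_of_nonneg_left
    (abs_sum_mul_sub_sum_mul_le (hπ0 x) (hπ1 x) fun y => ?_) hδ.1.le
  obtain ⟨hp0, hp1⟩ := hp y
  rw [add_sub_add_left_eq_sub, ← mul_sub, abs_mul, abs_of_nonneg (sub_nonneg.mpr hp1)]
  exact (mul_le_of_le_one_left (abs_nonneg _) (by linarith)).trans (hww' y)

end

end Stmt13
end

section
/- There exists exactly one continuous function W : [0,1]^N → (Fin N → ℝ) such that W(p)(x) = Φ^λ_p[W(p)](x) = f2(x) + λ·log(1 + exp((δ·Σ_y π(x,y)·(p(y)·W_S^λ(y) + (1 − p(y))·W(p)(y)) − f2(x))/λ)) for all p ∈ [0,1]^N and x ∈ Fin N. In particular, the follower's continuation value W^λ_C in the entropy-regularized Stackelberg stopping game depends continuously on the leader's Markov policy p. -/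
namespace Stmt14

noncomputable section

/-- The follower's regularized stopping value
`W_S^λ(y) = h2(y) + λ·log(1 + exp((g2(y) − h2(y))/λ))`. -/
def WSl (N : ℕ) (lam : ℝ) (g2 h2 : Fin N → ℝ) (y : Fin N) : ℝ :=
  h2 y + lam * Real.log (1 + Real.exp ((g2 y - h2 y) / lam))

/-- The entropy-regularized Bellman operator `Φ^λ_p` under the leader's policy `p`. -/
def PhiLam (N : ℕ) (π : Fin N → Fin N → ℝ) (δ lam : ℝ) (f2 g2 h2 : Fin N → ℝ)
    (p w : Fin N → ℝ) (x : Fin N) : ℝ :=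
  f2 x + lam * Real.log (1 + Real.exp
    ((δ * ∑ y, π x y * (p y * WSl N lam g2 h2 y + (1 - p y) * w y) - f2 x) / lam))

theorem log_one_add_exp_sub_le (s t : ℝ) :
    Real.log (1 + Real.exp s) - Real.log (1 + Real.exp t) ≤ |s - t| := by
  have hexp : Real.exp s ≤ Real.exp |s - t| * Real.exp t := by
    rw [← Real.exp_add, Real.exp_le_exp]
    linarith [le_abs_self (s - t)]
  have hone : 1 ≤ Real.exp |s - t| := Real.one_le_exp (abs_nonneg _)
  have hlog : Real.log (1 + Real.exp s) ≤
      Real.log (Real.exp |s - t| * (1 + Real.exp t)) :=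
    Real.log_le_log (by positivity) (by linarith)
  rw [Real.log_mul (by positivity) (by positivity), Real.log_exp] at hlog
  linarith

theorem abs_log_one_add_exp_sub_le (s t : ℝ) :
    |Real.log (1 + Real.exp s) - Real.log (1 + Real.exp t)| ≤ |s - t| :=
  abs_sub_le_iff.2 ⟨log_one_add_exp_sub_le s t, abs_sub_comm s t ▸ log_one_add_exp_sub_le t s⟩

/-- The regularized Bellman operator contracts the sup distance by the factor `δ`. -/
theorem abs_PhiLam_sub_le {N : ℕ} {π : Fin N → Fin N → ℝ} (hπ0 : ∀ x y, 0 ≤ π x y)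
    (hπ1 : ∀ x, ∑ y, π x y = 1) {δ lam : ℝ} (hδ : 0 ≤ δ) (hlam : 0 < lam)
    (f2 g2 h2 : Fin N → ℝ) {p : Fin N → ℝ} (hp : ∀ y, p y ∈ Set.Icc (0 : ℝ) 1)
    (w v : Fin N → ℝ) (x : Fin N) :
    |PhiLam N π δ lam f2 g2 h2 p w x - PhiLam N π δ lam f2 g2 h2 p v x| ≤ δ * dist w v := by
  have hsum : |∑ y, π x y * (p y * WSl N lam g2 h2 y + (1 - p y) * w y) -
      ∑ y, π x y * (p y * WSl N lam g2 h2 y + (1 - p y) * v y)| ≤ dist w v := by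
    rw [← Finset.sum_sub_distrib]
    calc _ ≤ ∑ y, π x y * dist w v := by
          refine (Finset.abs_sum_le_sum_abs _ _).trans (Finset.sum_le_sum fun y _ => ?_)
          rw [← mul_sub, abs_mul, abs_of_nonneg (hπ0 x y), add_sub_add_left_eq_sub, ← mul_sub,
            abs_mul, abs_of_nonneg (sub_nonneg.2 (hp y).2)]
          refine mul_le_mul_of_nonneg_left ?_ (hπ0 x y)
          exact (mul_le_of_le_one_left (abs_nonneg _) (by linarith [(hp y).1])).trans
            (dist_le_pi_dist w v y)
      _ = dist w v := by rw [← Finset.sum_mul, hπ1, one_mul]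
  unfold PhiLam
  rw [add_sub_add_left_eq_sub, ← mul_sub, abs_mul, abs_of_pos hlam]
  refine (mul_le_mul_of_nonneg_left (abs_log_one_add_exp_sub_le _ _) hlam.le).trans ?_
  rw [← sub_div, sub_sub_sub_cancel_right, ← mul_sub, abs_div, abs_of_pos hlam,
    mul_div_cancel₀ _ hlam.ne', abs_mul, abs_of_nonneg hδ]
  exact mul_le_mul_of_nonneg_left hsum hδ

/-- The Bellman operators of all policies, acting together on continuous functions of the
policy. -/
def bellmanMap {N : ℕ} (π : Fin N → Fin N → ℝ) (δ lam : ℝ) (f2 g2 h2 : Fin N → ℝ)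
    (W : C(Fin N → Set.Icc (0 : ℝ) 1, Fin N → ℝ)) : C(Fin N → Set.Icc (0 : ℝ) 1, Fin N → ℝ) where
  toFun p := PhiLam N π δ lam f2 g2 h2 (fun y => (p y : ℝ)) (W p)
  continuous_toFun := by
    refine continuous_pi fun x => ?_
    unfold PhiLam
    refine continuous_const.add (continuous_const.mul (Continuous.log ?_ fun p => by positivity))
    fun_prop

theorem contractingWith_bellmanMap {N : ℕ} {π : Fin N → Fin N → ℝ} (hπ0 : ∀ x y, 0 ≤ π x y)
    (hπ1 : ∀ x, ∑ y, π x y = 1) {δ lam : ℝ} (hδ : δ ∈ Set.Ioo (0 : ℝ) 1) (hlam : 0 < lam)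
    (f2 g2 h2 : Fin N → ℝ) :
    ContractingWith ⟨δ, hδ.1.le⟩ (bellmanMap π δ lam f2 g2 h2) := by
  refine ⟨hδ.2, LipschitzWith.of_dist_le_mul fun V W => ?_⟩
  have h0 : 0 ≤ δ * dist V W := mul_nonneg hδ.1.le dist_nonneg
  refine (ContinuousMap.dist_le h0).2 fun p => (dist_pi_le_iff h0).2 fun x => ?_
  exact (abs_PhiLam_sub_le hπ0 hπ1 hδ.1.le hlam f2 g2 h2 (fun y => (p y).2) (V p) (W p) x).trans
    (mul_le_mul_of_nonneg_left (ContinuousMap.dist_apply_le_dist p) hδ.1.le)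

/-- There is exactly one continuous function `W : [0,1]^N → ℝ^N` with
`W(p) = Φ^λ_p[W(p)]` for every `p`: the follower's continuation value in the
entropy-regularized game depends continuously on the leader's Markov policy. -/
theorem regularized_value_continuous_unique (N : ℕ) (hN : 1 ≤ N)
    (π : Fin N → Fin N → ℝ) (hπ0 : ∀ x y, 0 ≤ π x y) (hπ1 : ∀ x, ∑ y, π x y = 1)
    (δ lam : ℝ) (hδ : δ ∈ Set.Ioo (0:ℝ) 1) (hlam : 0 < lam)
    (f2 g2 h2 : Fin N → ℝ) :
    ∃! W : (Fin N → Set.Icc (0:ℝ) 1) → (Fin N → ℝ),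
      Continuous W ∧
      ∀ (p : Fin N → Set.Icc (0:ℝ) 1) (x : Fin N),
        W p x = PhiLam N π δ lam f2 g2 h2 (fun y => (p y : ℝ)) (W p) x := by
  have hT := contractingWith_bellmanMap hπ0 hπ1 hδ hlam f2 g2 h2
  refine ⟨hT.fixedPoint, ⟨ContinuousMap.continuous _, fun p x => ?_⟩, fun V hV => ?_⟩
  · exact congrFun (DFunLike.congr_fun hT.fixedPoint_isFixedPt p).symm x
  · have hfix : Function.IsFixedPt (bellmanMap π δ lam f2 g2 h2) ⟨V, hV.1⟩ :=
      ContinuousMap.ext fun p => funext fun x => (hV.2 p x).symm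
    exact congrArg DFunLike.coe (hT.fixedPoint_unique hfix)

end

end Stmt14
end

section
/- There exists exactly one continuous function V : [0,1]^N → (Fin N → ℝ) such that V(p)(x) = q*(p)(x)·g1(x) + (1 − q*(p)(x))·β·Σ_y π(x,y)·(p(y)·V_S^λ(y) + (1 − p(y))·V(p)(y)) for all p ∈ [0,1]^N and x ∈ Fin N. In particular, the leader's continuation value V^λ_C in the entropy-regularized Stackelberg stopping game is continuous in the leader's Markov policy p. -/
namespace Stmt15

noncomputable section

/-- The follower's regularized stopping value
`W_S^λ(y) = h2(y) + λ·log(1 + exp((g2(y) − h2(y))/λ))`. -/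
def WSl (N : ℕ) (lam : ℝ) (g2 h2 : Fin N → ℝ) (y : Fin N) : ℝ :=
  h2 y + lam * Real.log (1 + Real.exp ((g2 y - h2 y) / lam))

/-- The entropy-regularized Bellman operator `Φ^λ_p` under the leader's policy `p`. -/
def PhiLam (N : ℕ) (π : Fin N → Fin N → ℝ) (δ lam : ℝ) (f2 g2 h2 : Fin N → ℝ)
    (p w : Fin N → ℝ) (x : Fin N) : ℝ :=
  f2 x + lam * Real.log (1 + Real.exp
    ((δ * ∑ y, π x y * (p y * WSl N lam g2 h2 y + (1 - p y) * w y) - f2 x) / lam))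

/-- The follower's stop-scenario best response `r*(x) = 1/(1 + exp((g2(x) − h2(x))/λ))`. -/
def rstar (N : ℕ) (lam : ℝ) (g2 h2 : Fin N → ℝ) (x : Fin N) : ℝ :=
  1 / (1 + Real.exp ((g2 x - h2 x) / lam))

/-- The leader's regularized stopping value `V_S^λ(x) = r*(x)·h1(x) + (1 − r*(x))·f1(x)`. -/
def VSl (N : ℕ) (lam : ℝ) (f1 h1 g2 h2 : Fin N → ℝ) (x : Fin N) : ℝ :=
  rstar N lam g2 h2 x * h1 x + (1 - rstar N lam g2 h2 x) * f1 x

/-- The follower's continue-scenario best response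
`q*(p)(x) = 1/(1 + exp((δ·Σ_y π(x,y)·(p(y)·W_S^λ(y) + (1−p(y))·W(p)(y)) − f2(x))/λ))`. -/
def qstar (N : ℕ) (π : Fin N → Fin N → ℝ) (δ lam : ℝ) (f2 g2 h2 : Fin N → ℝ)
    (W : (Fin N → Set.Icc (0:ℝ) 1) → (Fin N → ℝ))
    (p : Fin N → Set.Icc (0:ℝ) 1) (x : Fin N) : ℝ :=
  1 / (1 + Real.exp
    ((δ * ∑ y, π x y * ((p y : ℝ) * WSl N lam g2 h2 y + (1 - (p y : ℝ)) * W p y) - f2 x) / lam))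

/-- An affine fixed-point equation `V p = c p + A p (V p)` whose matrices `A p` depend continuously on
a parameter in a compact space and have `ℓ∞` operator norm bounded by some `β < 1` has exactly one
continuous solution. -/
theorem existsUnique_continuous_affine_fixedPoint {X ι : Type*} [TopologicalSpace X]
    [CompactSpace X] [Fintype ι] (c : X → ι → ℝ) (A : X → ι → ι → ℝ) (hc : Continuous c)
    (hA : Continuous A) {β : ℝ} (hβ0 : 0 ≤ β) (hβ1 : β < 1)
    (hAβ : ∀ p x, ∑ y, |A p x y| ≤ β) :
    ∃! V : X → ι → ℝ, Continuous V ∧ ∀ p x, V p x = c p x + ∑ y, A p x y * V p y := by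
  let T : C(X, ι → ℝ) → C(X, ι → ℝ) := fun V =>
    ⟨fun p x => c p x + ∑ y, A p x y * V p y, by fun_prop⟩
  have hT : ContractingWith ⟨β, hβ0⟩ T := by
    refine ⟨hβ1, LipschitzWith.of_dist_le_mul fun U V => ?_⟩
    have hR : 0 ≤ β * dist U V := mul_nonneg hβ0 dist_nonneg
    refine (ContinuousMap.dist_le hR).2 fun p => (dist_pi_le_iff hR).2 fun x => ?_
    have hUV : ∀ y, |U p y - V p y| ≤ dist U V := fun y =>
      (dist_le_pi_dist (U p) (V p) y).trans (ContinuousMap.dist_apply_le_dist p)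
    calc dist (T U p x) (T V p x) = |∑ y, A p x y * (U p y - V p y)| := by
          simp [T, Real.dist_eq, mul_sub, Finset.sum_sub_distrib]
      _ ≤ ∑ y, |A p x y * (U p y - V p y)| := Finset.abs_sum_le_sum_abs _ _
      _ ≤ ∑ y, |A p x y| * dist U V := by
          refine Finset.sum_le_sum fun y _ => ?_
          rw [abs_mul]
          exact mul_le_mul_of_nonneg_left (hUV y) (abs_nonneg _)
      _ = (∑ y, |A p x y|) * dist U V := (Finset.sum_mul _ _ _).symm
      _ ≤ β * dist U V := mul_le_mul_of_nonneg_right (hAβ p x) dist_nonneg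
  refine ⟨hT.fixedPoint, ⟨map_continuous _, fun p x => ?_⟩, fun V ⟨hV, hVeq⟩ => ?_⟩
  · exact congrFun (DFunLike.congr_fun hT.fixedPoint_isFixedPt p) x |>.symm
  · have hfix : Function.IsFixedPt T ⟨V, hV⟩ :=
      ContinuousMap.ext fun p => funext fun x => (hVeq p x).symm
    exact congrArg DFunLike.coe (hT.fixedPoint_unique hfix)

theorem qstar_mem_Icc (N : ℕ) (π : Fin N → Fin N → ℝ) (δ lam : ℝ) (f2 g2 h2 : Fin N → ℝ)
    (W : (Fin N → Set.Icc (0:ℝ) 1) → (Fin N → ℝ)) (p : Fin N → Set.Icc (0:ℝ) 1) (x : Fin N) :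
    qstar N π δ lam f2 g2 h2 W p x ∈ Set.Icc (0:ℝ) 1 := by
  unfold qstar
  exact ⟨by positivity,
    div_le_one_of_le₀ (le_add_of_nonneg_right (Real.exp_pos _).le) (by positivity)⟩

theorem continuous_qstar (N : ℕ) (π : Fin N → Fin N → ℝ) (δ lam : ℝ) (f2 g2 h2 : Fin N → ℝ)
    (W : (Fin N → Set.Icc (0:ℝ) 1) → (Fin N → ℝ)) (hW : Continuous W) :
    Continuous (qstar N π δ lam f2 g2 h2 W) := by
  refine continuous_pi fun x => ?_
  unfold qstar
  refine Continuous.div continuous_const ?_ fun p => (by positivity)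
  simp only [div_eq_mul_inv]
  fun_prop

/-- Given the continuous follower value `W` of the entropy-regularized game, there is
exactly one continuous function `V : [0,1]^N → ℝ^N` with
`V(p)(x) = q*(p)(x)·g1(x) + (1 − q*(p)(x))·β·Σ_y π(x,y)·(p(y)·V_S^λ(y) + (1−p(y))·V(p)(y))`:
the leader's continuation value is continuous in the leader's Markov policy. -/
theorem leader_value_continuous_unique (N : ℕ) (hN : 1 ≤ N)
    (π : Fin N → Fin N → ℝ) (hπ0 : ∀ x y, 0 ≤ π x y) (hπ1 : ∀ x, ∑ y, π x y = 1)
    (δ β lam : ℝ) (hδ : δ ∈ Set.Ioo (0:ℝ) 1) (hβ : β ∈ Set.Ioo (0:ℝ) 1) (hlam : 0 < lam)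
    (f1 g1 h1 f2 g2 h2 : Fin N → ℝ)
    (W : (Fin N → Set.Icc (0:ℝ) 1) → (Fin N → ℝ)) (hWc : Continuous W)
    (hW : ∀ (p : Fin N → Set.Icc (0:ℝ) 1) (x : Fin N),
      W p x = PhiLam N π δ lam f2 g2 h2 (fun y => (p y : ℝ)) (W p) x) :
    ∃! V : (Fin N → Set.Icc (0:ℝ) 1) → (Fin N → ℝ),
      Continuous V ∧
      ∀ (p : Fin N → Set.Icc (0:ℝ) 1) (x : Fin N),
        V p x = qstar N π δ lam f2 g2 h2 W p x * g1 x +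
          (1 - qstar N π δ lam f2 g2 h2 W p x) *
            (β * ∑ y, π x y * ((p y : ℝ) * VSl N lam f1 h1 g2 h2 y +
              (1 - (p y : ℝ)) * V p y)) := by
  have hq := continuous_qstar N π δ lam f2 g2 h2 W hWc
  have hq01 := qstar_mem_Icc N π δ lam f2 g2 h2 W
  generalize qstar N π δ lam f2 g2 h2 W = q at hq hq01 ⊢
  generalize VSl N lam f1 h1 g2 h2 = S
  convert existsUnique_continuous_affine_fixedPoint
    (fun p x => q p x * g1 x + (1 - q p x) * (β * ∑ y, π x y * ((p y : ℝ) * S y)))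
    (fun p x y => (1 - q p x) * (β * (π x y * (1 - (p y : ℝ)))))
    (by fun_prop) (by fun_prop) hβ.1.le hβ.2 (fun p x => ?_) using 6 with V p x
  · simp only [mul_add, Finset.sum_add_distrib, Finset.mul_sum, mul_assoc, add_assoc]
  · calc ∑ y, |(1 - q p x) * (β * (π x y * (1 - (p y : ℝ))))| ≤ ∑ y, β * π x y := by
          refine Finset.sum_le_sum fun y _ => ?_
          have hq0 : 0 ≤ 1 - q p x := sub_nonneg.2 (hq01 p x).2
          have hp0 : 0 ≤ 1 - (p y : ℝ) := sub_nonneg.2 (p y).2.2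
          have hβπ : 0 ≤ β * π x y := mul_nonneg hβ.1.le (hπ0 x y)
          rw [← mul_assoc β, abs_of_nonneg (mul_nonneg hq0 (mul_nonneg hβπ hp0))]
          exact (mul_le_of_le_one_left (mul_nonneg hβπ hp0) (sub_le_self _ (hq01 p x).1)).trans
            (mul_le_of_le_one_right hβπ (sub_le_self _ (p y).2.1))
      _ = β := by rw [← Finset.mul_sum, hπ1, mul_one]

end

end Stmt15
end

section
/- There exists p ∈ [0,1]^N such that p ∈ Ψ(p); that is, there exists p ∈ [0,1]^N such that for every x ∈ Fin N, V_S(x) > V_C(p)(x) implies p(x) = 1, and V_S(x) < V_C(p)(x) implies p(x) = 0. Applied with V_S = V_S^λ and V_C = V^λ_C, this yields the existence of a regular randomized equilibrium for the entropy-regularized Stackelberg stopping game for every λ > 0. -/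
namespace Stmt17

/-- The cube `[0,1]^N` of randomized Markov stopping policies. -/
def cube (N : ℕ) : Set (Fin N → ℝ) := {p | ∀ x, p x ∈ Set.Icc (0:ℝ) 1}

/-- The leader's best-deviation correspondence
`Ψ(p) = {p̃ ∈ [0,1]^N : V_S(x) > V_C(p)(x) ⇒ p̃(x) = 1, V_S(x) < V_C(p)(x) ⇒ p̃(x) = 0}`. -/
def Psi (N : ℕ) (VS : Fin N → ℝ) (VC : (Fin N → ℝ) → (Fin N → ℝ))
    (p : Fin N → ℝ) : Set (Fin N → ℝ) :=
  {pt | (∀ x, pt x ∈ Set.Icc (0:ℝ) 1) ∧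
    ∀ x, (VS x > VC p x → pt x = 1) ∧ (VS x < VC p x → pt x = 0)}

section

open MeasureTheory

variable {E : Type*}

/-- The determinant of `1 + t • A` is a polynomial in `t` of degree at most the dimension. -/
lemma exists_polynomial_eval_eq_det_one_add_smul [NormedAddCommGroup E] [NormedSpace ℝ E]
    [FiniteDimensional ℝ E] (A : E →L[ℝ] E) :
    ∃ P : Polynomial ℝ, P.natDegree ≤ Module.finrank ℝ E ∧
      ∀ t : ℝ, P.eval t = (1 + t • A).det := by
  let b := Module.finBasis ℝ E
  let M := LinearMap.toMatrix b b (A : E →ₗ[ℝ] E)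
  let I : Matrix (Fin (Module.finrank ℝ E)) (Fin (Module.finrank ℝ E)) ℝ := 1
  refine ⟨((Polynomial.X : Polynomial ℝ) • M.map Polynomial.C + I.map Polynomial.C).det,
    ?_, fun t => ?_⟩
  · simpa using Polynomial.natDegree_det_X_add_C_le M I
  · rw [ContinuousLinearMap.det, ← LinearMap.det_toMatrix b, ← Polynomial.coe_evalRingHom,
      RingHom.map_det]
    congr 1
    ext i j
    simp [M, I, LinearMap.toMatrix_apply, Matrix.one_apply, apply_ite, Finsupp.single_apply,
      add_comm, eq_comm]
    exact mul_comm _ _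

/-- Extrapolation: the value at `1` of a polynomial of bounded degree is a fixed linear combination
of its values at finitely many points of `(0, ε)`. -/
lemma exists_polynomial_eval_one_eq_sum (d : ℕ) {ε : ℝ} (hε : 0 < ε) :
    ∃ (s : Finset ℝ) (w : ℝ → ℝ), (∀ t ∈ s, 0 < t ∧ t < ε) ∧
      ∀ P : Polynomial ℝ, P.natDegree ≤ d → P.eval 1 = ∑ t ∈ s, w t * P.eval t := by
  obtain ⟨s, hs, hcard⟩ := (Set.Ioo_infinite hε).exists_subset_card_eq (d + 1)
  refine ⟨s, fun t => (Lagrange.basis s id t).eval 1, fun t ht => hs ht, fun P hP => ?_⟩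
  have hdeg : P.degree < s.card := by
    rw [hcard]
    exact Polynomial.degree_le_natDegree.trans_lt (by exact_mod_cast Nat.lt_succ_of_le hP)
  conv_lhs => rw [Lagrange.eq_interpolate (v := id) Function.injective_id.injOn hdeg,
    Lagrange.interpolate_apply, Polynomial.eval_finsetSum]
  simp [mul_comm]

lemma det_one_add_pos_of_norm_lt_one [NormedAddCommGroup E] [NormedSpace ℝ E]
    [FiniteDimensional ℝ E] {A : E →L[ℝ] E} (hA : ‖A‖ < 1) : 0 < (1 + A).det := by
  have hne : ∀ s ∈ Set.Icc (0 : ℝ) 1, (1 + s • A).det ≠ 0 := by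
    intro s hs
    have hu : IsUnit (1 - (-(s • A))) := by
      apply isUnit_one_sub_of_norm_lt_one
      rw [norm_neg, norm_smul, Real.norm_of_nonneg hs.1]
      nlinarith [norm_nonneg A, hs.2]
    rw [sub_neg_eq_add] at hu
    exact (LinearMap.isUnit_det _ (hu.map (ContinuousLinearMap.toLinearMapRingHom : (E →L[ℝ] E) →+* E →ₗ[ℝ] E))).ne_zero
  have hcont : Continuous fun s : ℝ => (1 + s • A).det :=
    ContinuousLinearMap.continuous_det.comp (by fun_prop)
  by_contra! hneg
  obtain ⟨s, hs, h0⟩ := intermediate_value_Icc' zero_le_one hcont.continuousOn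
    (show (0 : ℝ) ∈ Set.Icc _ _ from ⟨by simpa using hneg, by simp [ContinuousLinearMap.det]⟩)
  exact hne s hs h0

/-- A small Lipschitz perturbation of the identity supported in a ball preserves integrals over
that ball, by change of variables. -/
lemma setIntegral_det_mul_comp_of_lipschitz_lt_one [NormedAddCommGroup E] [NormedSpace ℝ E]
    [FiniteDimensional ℝ E] [MeasurableSpace E] [BorelSpace E] (μ : Measure E)
    [μ.IsAddHaarMeasure] {v : E → E} (hv : Differentiable ℝ v) {K : NNReal} (hK : K < 1)
    (hvK : LipschitzWith K v) {R : ℝ}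
    (hR : ∀ x, x ∉ Metric.closedBall (0 : E) R → v x = 0) (φ : E → ℝ) :
    ∫ x in Metric.closedBall (0 : E) R, (1 + fderiv ℝ v x).det * φ (x + v x) ∂μ =
      ∫ x in Metric.closedBall (0 : E) R, φ x ∂μ := by
  have happ : ApproximatesLinearOn (fun x => x + v x)
      ((ContinuousLinearEquiv.refl ℝ E : E ≃L[ℝ] E) : E →L[ℝ] E) Set.univ K := by
    rw [ApproximatesLinearOn.approximatesLinearOn_iff_lipschitzOnWith, lipschitzOnWith_univ]
    convert hvK using 1
    ext x
    simp
  have hc : Subsingleton E ∨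
      K < ‖((ContinuousLinearEquiv.refl ℝ E).symm : E →L[ℝ] E)‖₊⁻¹ := by
    rcases subsingleton_or_nontrivial E with h | h
    · exact Or.inl h
    · right
      have : ‖((ContinuousLinearEquiv.refl ℝ E).symm : E →L[ℝ] E)‖₊ = 1 := by
        ext
        exact ContinuousLinearMap.norm_id
      simpa [this] using hK
  have hinj : Function.Injective fun x => x + v x :=
    fun x y hxy => congrArg Subtype.val
      (happ.injective hc (a₁ := ⟨x, trivial⟩) (a₂ := ⟨y, trivial⟩) hxy)
  have himage : (fun x => x + v x) '' Metric.closedBall (0 : E) R = Metric.closedBall 0 R := by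
    apply Set.Subset.antisymm
    · rintro _ ⟨x, hx, rfl⟩
      by_contra hy
      have h : x + v x = x := hinj (by simp [hR _ hy])
      exact hy (by simpa [h] using hx)
    · intro y hy
      obtain ⟨x, rfl⟩ := happ.surjective hc y
      by_cases hx : x ∈ Metric.closedBall (0 : E) R
      · exact ⟨x, hx, rfl⟩
      · exact absurd (by simpa [hR x hx] using hy) hx
  conv_rhs => rw [← himage]
  rw [integral_image_eq_integral_abs_det_fderiv_smul μ Metric.isClosed_closedBall.measurableSet
    (f' := fun x => 1 + fderiv ℝ v x)
    (f := fun x => x + v x)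
    (fun x _ => ((hasFDerivAt_id x).add (hv x).hasFDerivAt).hasFDerivWithinAt) hinj.injOn]
  congr 1
  ext x
  have hpos : 0 < (1 + fderiv ℝ v x).det := det_one_add_pos_of_norm_lt_one
    ((norm_fderiv_le_of_lipschitz ℝ hvK).trans_lt (by exact_mod_cast hK))
  rw [abs_of_pos hpos, smul_eq_mul]

/-- For compactly supported perturbations of the identity of any size, the change of variables
formula persists for polynomials in `‖x‖ ^ 2`, since both sides extend polynomially in a scaling
parameter. -/
lemma setIntegral_det_mul_pow_of_hasCompactSupport [NormedAddCommGroup E] [InnerProductSpace ℝ E]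
    [FiniteDimensional ℝ E] [MeasurableSpace E] [BorelSpace E] (μ : Measure E)
    [μ.IsAddHaarMeasure] {u : E → E} (hu : ContDiff ℝ 1 u) (hsupp : HasCompactSupport u) {R : ℝ}
    (hR : ∀ x, x ∉ Metric.closedBall (0 : E) R → u x = 0) (c : ℝ) (m : ℕ) :
    ∫ x in Metric.closedBall (0 : E) R,
        (1 + fderiv ℝ u x).det * (1 - c * ‖x + u x‖ ^ 2) ^ m ∂μ =
      ∫ x in Metric.closedBall (0 : E) R, (1 - c * ‖x‖ ^ 2) ^ m ∂μ := by
  obtain ⟨K, hK⟩ := ContDiff.lipschitzWith_of_hasCompactSupport hsupp hu one_ne_zero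
  have hdiff : Differentiable ℝ u := hu.differentiable one_ne_zero
  obtain ⟨s, w, hs, hw⟩ := exists_polynomial_eval_one_eq_sum (Module.finrank ℝ E + m * 2)
    (show (0 : ℝ) < 1 / (K + 1) by positivity)
  have hpoly : ∀ x, (1 + fderiv ℝ u x).det * (1 - c * ‖x + u x‖ ^ 2) ^ m =
      ∑ t ∈ s, w t * ((1 + t • fderiv ℝ u x).det * (1 - c * ‖x + t • u x‖ ^ 2) ^ m) := by
    intro x
    obtain ⟨P, hPdeg, hP⟩ := exists_polynomial_eval_eq_det_one_add_smul (fderiv ℝ u x)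
    let Q : Polynomial ℝ := Polynomial.C (-c * ‖u x‖ ^ 2) * Polynomial.X ^ 2 +
      Polynomial.C (-c * (2 * inner ℝ x (u x))) * Polynomial.X + Polynomial.C (1 - c * ‖x‖ ^ 2)
    have hQ : ∀ t, Q.eval t = 1 - c * ‖x + t • u x‖ ^ 2 := by
      intro t
      rw [norm_add_sq_real, inner_smul_right, norm_smul, mul_pow, Real.norm_eq_abs, sq_abs]
      simp [Q]
      ring
    have hdeg : (P * Q ^ m).natDegree ≤ Module.finrank ℝ E + m * 2 :=
      Polynomial.natDegree_mul_le.trans (add_le_add hPdeg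
        (Polynomial.natDegree_pow_le_of_le m Polynomial.natDegree_quadratic_le))
    simpa [hP, hQ] using hw _ hdeg
  have hone : ∑ t ∈ s, w t = 1 := by simpa using (hw 1 (by simp)).symm
  have hsmall : ∀ t ∈ s, ∫ x in Metric.closedBall (0 : E) R,
      (1 + t • fderiv ℝ u x).det * (1 - c * ‖x + t • u x‖ ^ 2) ^ m ∂μ =
        ∫ x in Metric.closedBall (0 : E) R, (1 - c * ‖x‖ ^ 2) ^ m ∂μ := by
    intro t ht
    have ht0 := (hs t ht).1
    have htK : ‖t‖₊ * K < 1 := by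
      rw [← NNReal.coe_lt_coe]
      have := (lt_div_iff₀ (by positivity)).1 (hs t ht).2
      simp only [NNReal.coe_mul, coe_nnnorm, Real.norm_of_nonneg ht0.le, NNReal.coe_one]
      linarith
    have h := setIntegral_det_mul_comp_of_lipschitz_lt_one μ (v := fun x => t • u x)
      (hdiff.const_smul t) htK ((lipschitzWith_smul t).comp hK)
      (R := R) (fun x hx => by simp [hR x hx]) (fun y => (1 - c * ‖y‖ ^ 2) ^ m)
    simpa [fderiv_fun_const_smul (hdiff _)] using h
  have hfd : Continuous (fderiv ℝ u) := hu.continuous_fderiv one_ne_zero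
  have hint : ∀ t ∈ s, IntegrableOn (fun x =>
      w t * ((1 + t • fderiv ℝ u x).det * (1 - c * ‖x + t • u x‖ ^ 2) ^ m))
      (Metric.closedBall (0 : E) R) μ := by
    intro t _
    apply Continuous.continuousOn _ |>.integrableOn_compact (isCompact_closedBall 0 R)
    have := hu.continuous
    have : Continuous fun x => (1 + t • fderiv ℝ u x).det :=
      ContinuousLinearMap.continuous_det.comp (by fun_prop)
    fun_prop
  simp_rw [hpoly]
  rw [integral_finsetSum _ hint]
  simp_rw [integral_const_mul]
  rw [Finset.sum_congr rfl fun t ht => by rw [hsmall t ht], ← Finset.sum_mul, hone, one_mul]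

lemma exists_add_eq_zero_of_contDiff_of_hasCompactSupport [NormedAddCommGroup E]
    [InnerProductSpace ℝ E] [FiniteDimensional ℝ E] {u : E → E} (hu : ContDiff ℝ 1 u)
    (hsupp : HasCompactSupport u) : ∃ x, x + u x = 0 := by
  borelize E
  let μ : Measure E := Measure.addHaar
  by_contra! hne
  obtain ⟨R, hRpos, hR⟩ : ∃ R > 0, ∀ x, x ∉ Metric.closedBall (0 : E) R → u x = 0 := by
    obtain ⟨R, hRpos, hR⟩ := hsupp.isCompact.isBounded.subset_closedBall_lt 0 0
    exact ⟨R, hRpos, fun x hx => image_eq_zero_of_notMem_tsupport fun h => hx (hR h)⟩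
  have hB := isCompact_closedBall (0 : E) R
  have hucont := hu.continuous
  have hcont : Continuous fun x => ‖x + u x‖ := by fun_prop
  have hdet : Continuous fun x => (1 + fderiv ℝ u x).det :=
    ContinuousLinearMap.continuous_det.comp
      (continuous_const.add (hu.continuous_fderiv one_ne_zero))
  obtain ⟨x₀, -, hx₀⟩ := hB.exists_isMinOn ⟨0, by simp [hRpos.le]⟩ hcont.continuousOn
  obtain ⟨M, hM⟩ := hB.exists_bound_of_continuousOn hcont.continuousOn
  obtain ⟨D, hD⟩ := hB.exists_bound_of_continuousOn hdet.continuousOn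
  set δ := min ‖x₀ + u x₀‖ R with hδ
  have hδpos : 0 < δ := lt_min (norm_pos_iff.2 (hne x₀)) hRpos
  set L := max M R with hL
  have hLpos : 0 < L := hRpos.trans_le (le_max_right _ _)
  have hδL : δ ≤ L := (min_le_right _ _).trans (le_max_right _ _)
  set c := (L ^ 2)⁻¹ with hc
  have hcpos : 0 < c := by positivity
  have hcL : c * L ^ 2 = 1 := inv_mul_cancel₀ (by positivity)
  have hle : ∀ r, 0 ≤ r → r ≤ L → c * r ^ 2 ≤ 1 := fun r h0 h1 => by
    rw [← hcL]; gcongr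
  set a := 1 - c * δ ^ 2 with ha
  set b := 1 - c * (δ / 2) ^ 2 with hb
  have ha0 : 0 ≤ a := sub_nonneg.2 (hle δ hδpos.le hδL)
  have hab : a < b := by
    have : 0 < c * δ ^ 2 := by positivity
    rw [ha, hb]; linarith [show c * (δ / 2) ^ 2 = c * δ ^ 2 / 4 by ring]
  have hb0 : 0 < b := ha0.trans_lt hab
  set V := μ.real (Metric.closedBall (0 : E) R)
  set v := μ.real (Metric.closedBall (0 : E) (δ / 2))
  have hv : 0 < v := ENNReal.toReal_pos
    (Metric.measure_closedBall_pos μ 0 (by positivity)).ne'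
    (isCompact_closedBall (0 : E) (δ / 2)).measure_lt_top.ne
  have hD0 : 0 ≤ D := (norm_nonneg _).trans (hD 0 (by simp [hRpos.le]))
  have hbound : ∀ m : ℕ, v * b ^ m ≤ D * V * a ^ m := by
    intro m
    calc v * b ^ m = ∫ x in Metric.closedBall (0 : E) (δ / 2), b ^ m ∂μ := by
          simp [v]
      _ ≤ ∫ x in Metric.closedBall (0 : E) (δ / 2), (1 - c * ‖x‖ ^ 2) ^ m ∂μ := by
          apply setIntegral_mono_on
          · exact continuousOn_const.integrableOn_compact (isCompact_closedBall _ _)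
          · exact (Continuous.continuousOn (by fun_prop)).integrableOn_compact
              (isCompact_closedBall _ _)
          · exact Metric.isClosed_closedBall.measurableSet
          · intro x hx
            have hx' : ‖x‖ ≤ δ / 2 := by simpa using hx
            rw [hb]
            gcongr
      _ ≤ ∫ x in Metric.closedBall (0 : E) R, (1 - c * ‖x‖ ^ 2) ^ m ∂μ := by
          apply setIntegral_mono_set
          · exact (Continuous.continuousOn (by fun_prop)).integrableOn_compact hB
          · filter_upwards [ae_restrict_mem Metric.isClosed_closedBall.measurableSet] with x hx
            have hx' : ‖x‖ ≤ R := by simpa using hx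
            exact pow_nonneg (sub_nonneg.2
              (hle _ (norm_nonneg _) (hx'.trans (le_max_right _ _)))) _
          · apply LE.le.eventuallyLE
            apply Metric.closedBall_subset_closedBall
            linarith [min_le_right ‖x₀ + u x₀‖ R]
      _ = ∫ x in Metric.closedBall (0 : E) R,
            (1 + fderiv ℝ u x).det * (1 - c * ‖x + u x‖ ^ 2) ^ m ∂μ :=
          (setIntegral_det_mul_pow_of_hasCompactSupport μ hu hsupp hR c m).symm
      _ ≤ ‖∫ x in Metric.closedBall (0 : E) R,
            (1 + fderiv ℝ u x).det * (1 - c * ‖x + u x‖ ^ 2) ^ m ∂μ‖ := le_abs_self _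
      _ ≤ D * a ^ m * V := by
          apply norm_setIntegral_le_of_norm_le_const hB.measure_lt_top
          intro x hx
          have h1 : ‖x + u x‖ ≤ L := by
            have := hM x hx
            rw [norm_norm] at this
            exact this.trans (le_max_left _ _)
          have h2 : δ ≤ ‖x + u x‖ := (min_le_left _ _).trans (hx₀ hx)
          have h3 : 0 ≤ 1 - c * ‖x + u x‖ ^ 2 := sub_nonneg.2 (hle _ (norm_nonneg _) h1)
          rw [norm_mul, norm_pow, Real.norm_of_nonneg h3]
          have h4 := hD x hx
          rw [ha]
          gcongr
      _ = D * V * a ^ m := by ring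
  have hq : a / b < 1 := (div_lt_one hb0).2 hab
  obtain ⟨m, hm⟩ := exists_pow_lt_of_lt_one (show 0 < v / (D * V + 1) by positivity) hq
  have h := hbound m
  rw [div_pow, div_lt_div_iff₀ (by positivity) (by positivity)] at hm
  nlinarith [pow_nonneg ha0 m]

/-- Brouwer's theorem for continuous maps with compact support. -/
lemma exists_fixedPoint_of_hasCompactSupport [NormedAddCommGroup E]
    [InnerProductSpace ℝ E] [FiniteDimensional ℝ E] {g : E → E} (hg : Continuous g)
    (hsupp : HasCompactSupport g) : ∃ x, g x = x := by
  by_contra! hne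
  obtain ⟨f, hf, hfg, hsub⟩ := hg.exists_contDiff_approx 1 (ε := fun x => dist (g x) x)
    (by fun_prop) (fun x => dist_pos.2 (hne x))
  obtain ⟨x, hx⟩ := exists_add_eq_zero_of_contDiff_of_hasCompactSupport (u := fun x => -f x)
    hf.neg (hsupp.mono (fun x hx => hsub (by simpa using hx)))
  have hfx : f x = x := by rwa [add_neg_eq_zero, eq_comm] at hx
  have := hfg x
  rw [hfx, dist_comm] at this
  exact this.false

/-- Brouwer's theorem for bounded continuous maps of a Euclidean space. -/
lemma exists_fixedPoint_of_continuous_of_bounded [NormedAddCommGroup E]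
    [InnerProductSpace ℝ E] [FiniteDimensional ℝ E] {g : E → E} (hg : Continuous g) {C : ℝ}
    (hC : ∀ x, ‖g x‖ ≤ C) : ∃ x, g x = x := by
  let χ : E → ℝ := fun x => max 0 (min 1 (C + 1 - ‖x‖))
  have hχ : Continuous χ := by fun_prop
  have hχ0 : ∀ x, 0 ≤ χ x := fun x => le_max_left _ _
  have hχ1 : ∀ x, χ x ≤ 1 := fun x => max_le zero_le_one (min_le_left _ _)
  obtain ⟨x, hx⟩ := exists_fixedPoint_of_hasCompactSupport (g := fun x => χ x • g x)
    (hχ.smul hg) (HasCompactSupport.intro (isCompact_closedBall (0 : E) (C + 1)) fun x hx => by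
      have : C + 1 < ‖x‖ := by simpa using hx
      have : χ x = 0 := max_eq_left ((min_le_right _ _).trans (by linarith))
      simp [this])
  have hxC : ‖x‖ ≤ C := by
    calc ‖x‖ = χ x * ‖g x‖ := by
          conv_lhs => rw [← hx]
          rw [norm_smul, Real.norm_of_nonneg (hχ0 x)]
      _ ≤ 1 * C := mul_le_mul (hχ1 x) (hC x) (norm_nonneg _) zero_le_one
      _ = C := one_mul C
  have hone : χ x = 1 := by
    simp only [χ]
    rw [min_eq_left (by linarith), max_eq_right zero_le_one]
  exact ⟨x, by simpa [hone] using hx⟩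

/-- A continuous map from `Fin N → ℝ` into the unit cube has a fixed point. -/
lemma exists_fixedPoint_pi_of_continuous_of_mem_Icc {N : ℕ} {g : (Fin N → ℝ) → (Fin N → ℝ)}
    (hg : Continuous g) (hI : ∀ p x, g p x ∈ Set.Icc (0 : ℝ) 1) : ∃ p, g p = p := by
  let e := EuclideanSpace.equiv (Fin N) ℝ
  have hbdd : ∃ C, ∀ y ∈ Set.Icc (0 : Fin N → ℝ) 1, ‖e.symm y‖ ≤ C :=
    isCompact_Icc.exists_bound_of_continuousOn e.symm.continuous.continuousOn
  obtain ⟨C, hC⟩ := hbdd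
  obtain ⟨y, hy⟩ := exists_fixedPoint_of_continuous_of_bounded (g := fun y => e.symm (g (e y)))
    (e.symm.continuous.comp (hg.comp e.continuous))
    (fun y => hC _ ⟨fun x => (hI _ x).1, fun x => (hI _ x).2⟩)
  exact ⟨e y, by simpa using congrArg e hy⟩

end

/-- For `V_C` continuous on the cube, the best-deviation correspondence `Ψ` has a
fixed point `p ∈ Ψ(p)`: a regular randomized equilibrium exists for the
entropy-regularized Stackelberg stopping game (for every `λ > 0`, taking
`V_S = V_S^λ` and `V_C = V^λ_C`). -/
theorem regular_randomized_equilibrium_exists (N : ℕ) (hN : 1 ≤ N)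
    (VS : Fin N → ℝ) (VC : (Fin N → ℝ) → (Fin N → ℝ))
    (hVC : ContinuousOn VC (cube N)) :
    ∃ p ∈ cube N, p ∈ Psi N VS VC p := by
  let q : (Fin N → ℝ) → (Fin N → ℝ) := fun p x => max 0 (min 1 (p x))
  have hqmem : ∀ p, q p ∈ cube N := fun p x =>
    ⟨le_max_left _ _, max_le zero_le_one (min_le_left _ _)⟩
  have hq : Continuous q := by fun_prop
  have hqp : ∀ p ∈ cube N, q p = p := fun p hp => funext fun x => by
    simp only [q]
    rw [min_eq_right (hp x).2, max_eq_right (hp x).1]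
  have hVCq : Continuous fun p => VC (q p) := hVC.comp_continuous hq hqmem
  obtain ⟨p, hp⟩ := exists_fixedPoint_pi_of_continuous_of_mem_Icc
    (g := fun p => q (q p + (VS - VC (q p))))
    (hq.comp (hq.add (continuous_const.sub hVCq))) (fun p => hqmem _)
  have hpc : p ∈ cube N := hp ▸ hqmem _
  simp only [hqp p hpc] at hp
  refine ⟨p, hpc, hpc, fun x => ?_⟩
  have hx : max 0 (min 1 (p x + (VS x - VC p x))) = p x := congrFun hp x
  constructor <;> intro h <;> grind

end Stmt17
end

section
/- There exists K0 ∈ ℝ such that for every K ≥ K0 the following holds: for every p ∈ [0,1]³ and all functions w, v : Fin 3 → ℝ satisfying the follower's Bellman system w(x) = max{f2(x), δ·Σ_y π(x,y)·(p(y)·g2(y) + (1 − p(y))·w(y))} for all x, and the leader's system v(x) = g1(x)·1{w(x) = f2(x)} + β·(Σ_y π(x,y)·(p(y)·f1(y) + (1 − p(y))·v(y)))·1{w(x) > f2(x)} for all x, the policy p is not a randomized equilibrium: there exist x ∈ Fin 3 and q ∈ [0,1] with p(x)·f1(x) + (1 − p(x))·v(x) < q·f1(x) + (1 − q)·v(x).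 Hence a randomized Markov (stationary) equilibrium strategy of the infinite-horizon Stackelberg stopping game may fail to exist. -/
namespace Stmt18

noncomputable section

/-- Leader's stopping payoff `f1 = (1, K, 1)` on states `(a,b,c)`. -/
def f1 (K : ℝ) : Fin 3 → ℝ := ![1, K, 1]

/-- Leader's payoff when the follower stops, `g1 = (K², K+1, 2)`. -/
def g1 (K : ℝ) : Fin 3 → ℝ := ![K ^ 2, K + 1, 2]

/-- Follower's stopping payoff `f2 = (K, 1, K²)`. -/
def f2 (K : ℝ) : Fin 3 → ℝ := ![K, 1, K ^ 2]

/-- Follower's payoff when the leader stops, `g2 = (K+1, 2, K²+1)`. -/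
def g2 (K : ℝ) : Fin 3 → ℝ := ![K + 1, 2, K ^ 2 + 1]

/-- A weighted average is at most any upper bound of the averaged values. -/
lemma weighted_sum_le {ι : Type*} [Fintype ι] {a F : ι → ℝ} {C : ℝ} (ha : ∀ y, 0 ≤ a y)
    (hsum : ∑ y, a y = 1) (hF : ∀ y, F y ≤ C) : ∑ y, a y * F y ≤ C :=
  calc ∑ y, a y * F y ≤ ∑ y, a y * C :=
        Finset.sum_le_sum fun y _ => mul_le_mul_of_nonneg_left (hF y) (ha y)
    _ = C := by rw [← Finset.sum_mul, hsum, one_mul]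

/-- A convex combination is at most any common upper bound. -/
lemma mix_le {p a b C : ℝ} (hp : p ∈ Set.Icc (0:ℝ) 1) (ha : a ≤ C) (hb : b ≤ C) :
    p * a + (1 - p) * b ≤ C := by
  nlinarith [mul_nonneg hp.1 (sub_nonneg.2 ha), mul_nonneg (sub_nonneg.2 hp.2) (sub_nonneg.2 hb)]

/-- A convex combination of nonnegative numbers is nonnegative. -/
lemma mix_nonneg {p a b : ℝ} (hp : p ∈ Set.Icc (0:ℝ) 1) (ha : 0 ≤ a) (hb : 0 ≤ b) :
    0 ≤ p * a + (1 - p) * b :=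
  add_nonneg (mul_nonneg hp.1 ha) (mul_nonneg (sub_nonneg.2 hp.2) hb)

/-- An optimal mixture puts no weight on the strictly worse first option. -/
lemma weight_eq_zero {p a b : ℝ} (hp : 0 ≤ p) (hab : a < b) (h : b ≤ p * a + (1 - p) * b) :
    p = 0 := by
  nlinarith

/-- An optimal mixture puts full weight on the strictly better first option. -/
lemma weight_eq_one {p a b : ℝ} (hp : p ≤ 1) (hab : b < a) (h : a ≤ p * a + (1 - p) * b) :
    p = 1 := by
  nlinarith

/-- For large `K` the follower's value never exceeds `K²`. -/
lemma follower_value_le {δ K : ℝ} (hδ : δ ∈ Set.Ioo (0:ℝ) 1) {π : Fin 3 → Fin 3 → ℝ}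
    (hπ1 : ∀ x, ∑ y, π x y = 1) (hπ0 : ∀ x y, 0 ≤ π x y) (hK : 2 ≤ K)
    (hKδ : 1 < (1 - δ) * K) {p w : Fin 3 → ℝ} (hp : ∀ x, p x ∈ Set.Icc (0:ℝ) 1)
    (hw : ∀ x, w x = max (f2 K x) (δ * ∑ y, π x y * (p y * g2 K y + (1 - p y) * w y)))
    (x : Fin 3) : w x ≤ K ^ 2 := by
  obtain ⟨z, hz⟩ := Finite.exists_max w
  refine (hz x).trans ?_
  by_contra! hlt
  have hf : f2 K z ≤ K ^ 2 := by
    fin_cases z <;> simp [f2, -one_le_sq_iff_one_le_abs] <;> nlinarith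
  have hg : ∀ y, g2 K y ≤ max (K ^ 2 + 1) (w z) := fun y => by
    refine le_trans ?_ (le_max_left _ _)
    fin_cases y <;> simp [g2] <;> nlinarith
  have hsum := weighted_sum_le (hπ0 z) (hπ1 z) fun y =>
    mix_le (hp y) (hg y) ((hz y).trans (le_max_right (K ^ 2 + 1) (w z)))
  have hcont : w z ≤ δ * max (K ^ 2 + 1) (w z) := by
    rcases le_max_iff.1 (hw z).le with h | h
    · linarith
    · exact h.trans (mul_le_mul_of_nonneg_left hsum hδ.1.le)
  rcases max_cases (K ^ 2 + 1) (w z) with ⟨h, -⟩ | ⟨h, -⟩ <;> rw [h] at hcont <;>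
    nlinarith [hδ.1, hδ.2]

/-- In the three-state infinite-horizon Stackelberg stopping game with the payoffs above
(and `h_i = (f_i + g_i)/2`, so that `W_S = g2` and `V_S = f1`), for all large enough `K`
no randomized Markov policy `p ∈ [0,1]³` is an equilibrium: whenever `w` solves the
follower's Bellman system and `v` solves the leader's system, some state `x` admits a
profitable deviation `q ∈ [0,1]`.  Hence a randomized Markov (stationary) equilibrium
strategy may fail to exist. -/
theorem no_randomized_markov_equilibrium
    (β δ : ℝ) (hβ : β ∈ Set.Ioo (0:ℝ) 1) (hδ : δ ∈ Set.Ioo (0:ℝ) 1)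
    (π : Fin 3 → Fin 3 → ℝ) (hπ1 : ∀ x, ∑ y, π x y = 1)
    (hπac : π 0 2 = 0)
    (hπpos : ∀ x y : Fin 3, (x, y) ≠ ((0 : Fin 3), (2 : Fin 3)) → 0 < π x y) :
    ∃ K0 : ℝ, ∀ K ≥ K0,
      ∀ p : Fin 3 → ℝ, (∀ x, p x ∈ Set.Icc (0:ℝ) 1) →
      ∀ w v : Fin 3 → ℝ,
        (∀ x, w x = max (f2 K x) (δ * ∑ y, π x y * (p y * g2 K y + (1 - p y) * w y))) →
        (∀ x, v x = (if w x = f2 K x then g1 K x else 0) +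
          (if f2 K x < w x then β * ∑ y, π x y * (p y * f1 K y + (1 - p y) * v y) else 0)) →
        ∃ x : Fin 3, ∃ q ∈ Set.Icc (0:ℝ) 1,
          p x * f1 K x + (1 - p x) * v x < q * f1 K x + (1 - q) * v x := by
  have hab : 0 < π 0 1 := hπpos 0 1 (by decide)
  have hba : 0 < π 1 0 := hπpos 1 0 (by decide)
  have hbc : 0 < π 1 2 := hπpos 1 2 (by decide)
  have hπ0 : ∀ x y, 0 ≤ π x y := fun x y => by
    by_cases h : (x, y) = ((0 : Fin 3), (2 : Fin 3))
    · obtain ⟨rfl, rfl⟩ := Prod.mk.inj h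
      exact hπac.ge
    · exact (hπpos x y h).le
  have large : ∀ c : ℝ, 0 < c → ∀ᶠ K in Filter.atTop, 1 < c * K := fun c hc =>
    (Filter.tendsto_id.const_mul_atTop hc).eventually_gt_atTop 1
  obtain ⟨K0, hK0⟩ := Filter.eventually_atTop.1
    ((Filter.eventually_ge_atTop (2:ℝ)).and
      ((large (1 - δ) (sub_pos.2 hδ.2)).and
        ((large (δ * π 1 2) (mul_pos hδ.1 hbc)).and
          ((large (β * π 1 0) (mul_pos hβ.1 hba)).and
            ((large (β * π 0 1) (mul_pos hβ.1 hab)).and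
              (large (δ * π 0 1 * (δ * π 1 2))
                (mul_pos (mul_pos hδ.1 hab) (mul_pos hδ.1 hbc))))))))
  refine ⟨K0, fun K hK p hp w v hw hv => ?_⟩
  obtain ⟨hK2, hKδ, hKbc, hKba, hKab, hKabc⟩ := hK0 K hK
  by_contra! hopt
  have hPv : ∀ x, v x ≤ p x * f1 K x + (1 - p x) * v x := fun x => by
    simpa using hopt x 0 (by simp)
  have hPf : ∀ x, f1 K x ≤ p x * f1 K x + (1 - p x) * v x := fun x => by
    simpa using hopt x 1 (by simp)
  have hwf : ∀ x, f2 K x ≤ w x := fun x => (le_max_left _ _).trans (hw x).ge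
  have hwc : ∀ x, δ * ∑ y, π x y * (p y * g2 K y + (1 - p y) * w y) ≤ w x :=
    fun x => (le_max_right _ _).trans (hw x).ge
  have hwle := follower_value_le hδ hπ1 hπ0 hK2 hKδ hp hw
  have hf2 : ∀ x, 0 ≤ f2 K x := fun x => by fin_cases x <;> simp [f2] <;> positivity
  have hg2 : ∀ x, 0 ≤ g2 K x := fun x => by fin_cases x <;> simp [g2] <;> positivity
  have hf1 : ∀ x, 0 ≤ f1 K x := fun x => by fin_cases x <;> simp [f1]; positivity
  have hM : ∀ y, 0 ≤ p y * g2 K y + (1 - p y) * w y := fun y =>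
    mix_nonneg (hp y) (hg2 y) ((hf2 y).trans (hwf y))
  have hP : ∀ y, 0 ≤ p y * f1 K y + (1 - p y) * v y := fun y => (hf1 y).trans (hPf y)
  have single : ∀ (x y : Fin 3) (F : Fin 3 → ℝ), (∀ y, 0 ≤ F y) →
      π x y * F y ≤ ∑ z, π x z * F z := fun x y F hF =>
    Finset.single_le_sum (f := fun z => π x z * F z)
      (fun z _ => mul_nonneg (hπ0 x z) (hF z)) (Finset.mem_univ y)
  -- The follower stops at `c`, so the leader continues there.
  have hw2 : w 2 = K ^ 2 := le_antisymm (hwle 2) (hwf 2)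
  have hv2 : v 2 = 2 := by
    rw [hv 2]; simp [hw2, f2, g1]
  have hp2 : p 2 = 0 :=
    weight_eq_zero (hp 2).1 (by simp [f1, hv2]) (hPv 2)
  -- The follower continues at `b`.
  have hw1 : δ * π 1 2 * K ^ 2 ≤ w 1 := by
    have h := single 1 2 _ hM
    rw [hp2, hw2] at h
    have := mul_le_mul_of_nonneg_left h hδ.1.le
    have := hwc 1
    linarith
  have hw1' : f2 K 1 < w 1 := by
    refine lt_of_lt_of_le ?_ hw1
    simp only [f2, Matrix.cons_val_one, Matrix.cons_val_zero]
    nlinarith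
  have hv1 : v 1 = β * ∑ y, π 1 y * (p y * f1 K y + (1 - p y) * v y) := by
    rw [hv 1]; simp [hw1', hw1'.ne']
  rcases (hwf 0).eq_or_lt with h0 | h0
  · -- The follower stops at `a`.
    have hv0 : v 0 = K ^ 2 := by
      rw [hv 0]; simp [← h0, g1]
    have hp0 : p 0 = 0 :=
      weight_eq_zero (hp 0).1 (by simp only [f1, hv0, Matrix.cons_val_zero]; nlinarith) (hPv 0)
    have hv1K : K < v 1 := by
      have h := single 1 0 _ hP
      rw [hp0, hv0] at h
      have := mul_le_mul_of_nonneg_left h hβ.1.le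
      rw [hv1]
      nlinarith
    have hp1 : p 1 = 0 := weight_eq_zero (hp 1).1 (by simpa [f1] using hv1K) (hPv 1)
    have h := single 0 1 _ hM
    rw [hp1] at h
    have h1 := mul_le_mul_of_nonneg_left h hδ.1.le
    have h2 := hwc 0
    have h3 := mul_le_mul_of_nonneg_left hw1 (mul_pos hδ.1 hab).le
    have h4 : w 0 = K := by rw [← h0]; simp [f2]
    nlinarith
  · -- The follower continues at `a`.
    have h0K : K < w 0 := by simpa [f2] using h0
    have hv0 : v 0 = β * ∑ y, π 0 y * (p y * f1 K y + (1 - p y) * v y) := by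
      rw [hv 0]; simp [h0, h0.ne']
    have hPle : ∀ y, p y * f1 K y + (1 - p y) * v y ≤ K := by
      obtain ⟨z, hz⟩ := Finite.exists_max fun y => p y * f1 K y + (1 - p y) * v y
      refine fun y => (hz y).trans ?_
      by_contra! hlt
      have hs := fun x => mul_le_mul_of_nonneg_left
        (weighted_sum_le (hπ0 x) (hπ1 x) hz) hβ.1.le
      have hvK : v z ≤ max K (β * (p z * f1 K z + (1 - p z) * v z)) := by
        fin_cases z
        · exact le_max_of_le_right (hv0.le.trans (hs 0))
        · exact le_max_of_le_right (hv1.le.trans (hs 1))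
        · exact le_max_of_le_left (hv2.le.trans hK2)
      have hfK : f1 K z ≤ K := by fin_cases z <;> simp [f1] <;> linarith
      have := mix_le (hp z) (hfK.trans (le_max_left _ _)) hvK
      rcases le_max_iff.1 this with h | h
      · linarith
      · nlinarith [hβ.1, hβ.2]
    have hv1K : v 1 < K := by
      have := mul_le_mul_of_nonneg_left (weighted_sum_le (hπ0 1) (hπ1 1) hPle) hβ.1.le
      nlinarith [hβ.1, hβ.2]
    have hp1 : p 1 = 1 := weight_eq_one (hp 1).2 (by simpa [f1] using hv1K) (hPf 1)
    have hv0' : 1 < v 0 := by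
      have h := single 0 1 _ hP
      have h1 := mul_le_mul_of_nonneg_left h hβ.1.le
      simp only [hp1, f1, Matrix.cons_val_one, Matrix.cons_val_zero] at h1
      rw [hv0]
      simp only [f1]
      linarith
    have hp0 : p 0 = 0 := weight_eq_zero (hp 0).1 (by simpa [f1] using hv0') (hPv 0)
    have hc : w 0 ≤ δ * ∑ y, π 0 y * (p y * g2 K y + (1 - p y) * w y) := by
      rcases le_max_iff.1 (hw 0).le with h | h
      · exact absurd h h0.not_ge
      · exact h
    have hsum := hπ1 0
    simp only [Fin.sum_univ_three, hπac, hp0, hp1, g2, Matrix.cons_val_one,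
      Matrix.cons_val_zero] at hc hsum
    have h1 : π 0 0 * w 0 + π 0 1 * 2 ≤ w 0 := by nlinarith
    nlinarith [mul_le_mul_of_nonneg_left h1 hδ.1.le, hδ.1, hδ.2]

end

end Stmt18
end
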